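/- arXiv:1704.01684 — 8 statements merged into one kernel-verified Lean document; each statement's English description precedes it below -/
import Mathlib

section
/- The homomorphism from W to the product ∏_{i=0}^{n} ℤ/pᵢℤ sending the generator xᵢ to the class of 1 in the i-th factor (and to 0 in all other factors) is a well-defined surjective group homomorphism, and its kernel is the cyclic subgroup generated by the distinguished element c = p₀x₀ = p₁x₁ = ⋯ = pₙxₙ; moreover c has infinite order in W. In particular W is an abelian group of rank one. -/
/-!
For integers `n ≥ 0` and `p₀, …, pₙ ≥ 2`, the abelian group `W` with generators
`x₀, …, xₙ` and relations `p₀x₀ = p₁x₁ = ⋯ = pₙxₙ` is realized as the quotient of the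
free abelian group `ℤ^{n+1}` (with basis `e₀, …, eₙ`) by the subgroup generated by the
elements `p₀e₀ − pᵢeᵢ`.
-/

/-- The subgroup of relations `p₀e₀ − pᵢeᵢ` in the free abelian group `ℤ^{n+1}`. -/
def Wrel (n : ℕ) (p : Fin (n + 1) → ℕ) : AddSubgroup (Fin (n + 1) → ℤ) :=
  AddSubgroup.closure
    {v | ∃ i : Fin (n + 1),
      v = (p 0 : ℤ) • Pi.single (0 : Fin (n + 1)) (1 : ℤ) - (p i : ℤ) • Pi.single i (1 : ℤ)}

/-- The abelian group `W` with generators `x₀, …, xₙ` and relations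
`p₀x₀ = p₁x₁ = ⋯ = pₙxₙ`. -/
abbrev Wgrp (n : ℕ) (p : Fin (n + 1) → ℕ) : Type :=
  (Fin (n + 1) → ℤ) ⧸ Wrel n p

/-- The generator `xᵢ` of `W`, i.e. the class of the basis vector `eᵢ`. -/
def Wx (n : ℕ) (p : Fin (n + 1) → ℕ) (i : Fin (n + 1)) : Wgrp n p :=
  QuotientAddGroup.mk (Pi.single i (1 : ℤ))

theorem Wx_rel (n : ℕ) (p : Fin (n + 1) → ℕ) (i : Fin (n + 1)) :
    (p i : ℤ) • Wx n p i = (p 0 : ℤ) • Wx n p 0 := by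
  have h : (p 0 : ℤ) • Pi.single (0 : Fin (n + 1)) (1 : ℤ) - (p i : ℤ) • Pi.single i (1 : ℤ)
      ∈ Wrel n p := AddSubgroup.subset_closure ⟨i, rfl⟩
  have h2 := (QuotientAddGroup.eq_zero_iff _).2 h
  exact (sub_eq_zero.1 h2).symm

theorem Wmk_eq (n : ℕ) (p : Fin (n + 1) → ℕ) (v : Fin (n + 1) → ℤ) :
    (QuotientAddGroup.mk v : Wgrp n p) = ∑ i, v i • Wx n p i := by
  have hv : v = ∑ i, v i • (Pi.single i (1 : ℤ) : Fin (n + 1) → ℤ) := pi_eq_sum_univ' v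
  conv_lhs => rw [hv]
  change QuotientAddGroup.mk' (Wrel n p) _ = _
  rw [map_sum]
  simp only [map_zsmul]
  rfl

def Wdeg (n : ℕ) (p : Fin (n + 1) → ℕ) (hp : ∀ i, 2 ≤ p i) : Wgrp n p →+ ℚ :=
  QuotientAddGroup.lift (Wrel n p)
    { toFun := fun v => ∑ i, (v i : ℚ) / (p i : ℚ)
      map_zero' := by simp
      map_add' := fun v w => by simp [add_div, Finset.sum_add_distrib] }
    (by
      rw [Wrel, AddSubgroup.closure_le]
      rintro v ⟨i, rfl⟩
      have hq : ∀ j, (p j : ℚ) ≠ 0 := fun j => by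
        have := hp j
        positivity
      have key : ∀ j, ∑ k, ((((p j : ℤ) • Pi.single j (1 : ℤ) : Fin (n + 1) → ℤ) k : ℤ) : ℚ)
          / (p k : ℚ) = 1 := fun j => by
        rw [Finset.sum_eq_single j]
        · simp [hq j]
        · intro b _ hb
          simp [hb]
        · simp
      have h0 := key 0
      have h1 := key i
      simp only [SetLike.mem_coe, AddMonoidHom.mem_ker, AddMonoidHom.coe_mk, ZeroHom.coe_mk,
        Pi.sub_apply, Int.cast_sub, sub_div, Finset.sum_sub_distrib]
      rw [h0, h1, sub_self])

theorem Wdeg_c (n : ℕ) (p : Fin (n + 1) → ℕ) (hp : ∀ i, 2 ≤ p i) :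
    Wdeg n p hp ((p 0 : ℤ) • Wx n p 0) = 1 := by
  have hq : (p 0 : ℚ) ≠ 0 := by
    have := hp 0
    positivity
  have : Wdeg n p hp (Wx n p 0) = 1 / (p 0 : ℚ) := by
    change ∑ i, (((Pi.single 0 1 : Fin (n + 1) → ℤ) i : ℤ) : ℚ) / (p i : ℚ) = _
    rw [Finset.sum_eq_single 0]
    · simp
    · intro b _ hb
      simp [hb]
    · simp
  rw [map_zsmul, this]
  simp [hq]

def Wphi (n : ℕ) (p : Fin (n + 1) → ℕ) : Wgrp n p →+ (∀ i : Fin (n + 1), ZMod (p i)) :=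
  QuotientAddGroup.lift (Wrel n p)
    { toFun := fun v i => (v i : ZMod (p i))
      map_zero' := by ext; simp
      map_add' := fun v w => by ext; simp }
    (by
      rw [Wrel, AddSubgroup.closure_le]
      rintro v ⟨i, rfl⟩
      have key : ∀ j k, ((((p j : ℤ) • Pi.single j (1 : ℤ) : Fin (n + 1) → ℤ) k : ℤ) : ZMod (p k))
          = 0 := fun j k => by
        by_cases h : k = j
        · subst h
          simp
        · simp [h]
      simp only [SetLike.mem_coe, AddMonoidHom.mem_ker, AddMonoidHom.coe_mk, ZeroHom.coe_mk]
      ext k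
      rw [Pi.sub_apply, Int.cast_sub, key, key, sub_self]
      rfl)

theorem Wphi_mk (n : ℕ) (p : Fin (n + 1) → ℕ) (v : Fin (n + 1) → ℤ) (i : Fin (n + 1)) :
    Wphi n p (QuotientAddGroup.mk v) i = (v i : ZMod (p i)) := rfl

theorem Wphi_x (n : ℕ) (p : Fin (n + 1) → ℕ) (i : Fin (n + 1)) :
    Wphi n p (Wx n p i) = Pi.single i (1 : ZMod (p i)) := by
  ext k
  rw [Wx, Wphi_mk]
  by_cases h : k = i
  · subst h
    simp
  · simp [h]

theorem Wphi_ker (n : ℕ) (p : Fin (n + 1) → ℕ) :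
    (Wphi n p).ker = AddSubgroup.zmultiples ((p 0 : ℤ) • Wx n p 0) := by
  apply le_antisymm
  · intro w hw
    obtain ⟨v, rfl⟩ := QuotientAddGroup.mk_surjective w
    have h : ∀ i, ∃ k : ℤ, v i = (p i : ℤ) * k := fun i => by
      have := congrFun hw i
      rw [Wphi_mk] at this
      exact (ZMod.intCast_zmod_eq_zero_iff_dvd _ _).1 this
    choose k hk using h
    rw [Wmk_eq]
    refine AddSubgroup.sum_mem _ fun i _ => ?_
    rw [hk i, mul_comm, mul_smul, Wx_rel n p i]
    exact AddSubgroup.mem_zmultiples_iff.2 ⟨k i, rfl⟩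
  · refine AddSubgroup.zmultiples_le_of_mem ?_
    rw [AddMonoidHom.mem_ker, map_zsmul, Wphi_x]
    ext k
    by_cases h : k = 0
    · subst h
      simp
    · simp [h]

theorem Wc_inj (n : ℕ) (p : Fin (n + 1) → ℕ) (hp : ∀ i, 2 ≤ p i) (m : ℤ)
    (h : m • ((p 0 : ℤ) • Wx n p 0) = 0) : m = 0 := by
  have h2 := congrArg (Wdeg n p hp) h
  rw [map_zsmul, Wdeg_c, map_zero] at h2
  simpa using h2

theorem W_rank (n : ℕ) (p : Fin (n + 1) → ℕ) (hp : ∀ i, 2 ≤ p i) :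
    Module.rank ℤ (Wgrp n p) = 1 := by
  set c : Wgrp n p := (p 0 : ℤ) • Wx n p 0 with hc
  have hS : Module.rank ℤ (Submodule.span ℤ {c}) = 1 := by
    have hli : LinearIndepOn ℤ id ({c} : Set (Wgrp n p)) := by
      refine LinearIndependent.of_subsingleton' ⟨c, rfl⟩ fun m hm => ?_
      exact Wc_inj n p hp m hm
    rw [rank_span_set hli, Cardinal.mk_singleton]
  have hQ : Module.rank ℤ (Wgrp n p ⧸ Submodule.span ℤ {c}) = 0 := by
    rw [rank_eq_zero_iff]
    intro x
    obtain ⟨w, rfl⟩ := Submodule.Quotient.mk_surjective _ x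
    refine ⟨∏ i, (p i : ℤ), ?_, ?_⟩
    · refine Finset.prod_ne_zero_iff.2 fun i _ => ?_
      have := hp i
      positivity
    · rw [← Submodule.Quotient.mk_smul, Submodule.Quotient.mk_eq_zero,
        Submodule.mem_span_singleton]
      have : (∏ i, (p i : ℤ)) • w ∈ (Wphi n p).ker := by
        rw [AddMonoidHom.mem_ker, map_zsmul]
        ext k
        have h0 : (((∏ i, (p i : ℤ)) : ℤ) : ZMod (p k)) = 0 :=
          (ZMod.intCast_zmod_eq_zero_iff_dvd _ _).2
            (Finset.dvd_prod_of_mem (fun i => (p i : ℤ)) (Finset.mem_univ k))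
        rw [Pi.smul_apply, zsmul_eq_mul, h0, zero_mul]
        rfl
      rw [Wphi_ker] at this
      exact AddSubgroup.mem_zmultiples_iff.1 this
  rw [← Submodule.rank_quotient_add_rank (Submodule.span ℤ {c}), hQ, hS, zero_add]

theorem picard_group_structure (n : ℕ) (p : Fin (n + 1) → ℕ) (hp : ∀ i, 2 ≤ p i) :
    ∃ φ : Wgrp n p →+ (∀ i : Fin (n + 1), ZMod (p i)),
      (∀ i : Fin (n + 1), φ (Wx n p i) = Pi.single i (1 : ZMod (p i))) ∧
      Function.Surjective φ ∧
      φ.ker = AddSubgroup.zmultiples ((p 0 : ℤ) • Wx n p 0) ∧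
      ¬ IsOfFinAddOrder ((p 0 : ℤ) • Wx n p 0) ∧
      Module.rank ℤ (Wgrp n p) = 1 := by
  refine ⟨Wphi n p, Wphi_x n p, ?_, Wphi_ker n p, ?_, W_rank n p hp⟩
  · intro y
    choose v hv using fun i => ZMod.intCast_surjective (y i)
    exact ⟨QuotientAddGroup.mk v, funext hv⟩
  · rw [isOfFinAddOrder_iff_nsmul_eq_zero]
    rintro ⟨m, hm, h⟩
    have := Wc_inj n p hp m (by rw [natCast_zsmul]; exact h)
    omega
end

section
/- There is a well-defined group homomorphism deg: W → ℚ with deg(xᵢ) = 1/pᵢ for all i = 0,…,n. Its image is the subgroup (1/m)ℤ = {a/m : a ∈ ℤ} of ℚ, where m = lcm(p₀,…,pₙ), and its kernel is exactly the torsion subgroup of W. In other words, there is an exact sequence 0 → W_tors → W → (1/m)ℤ → 0 induced by deg. -/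
/-- There is a well-defined degree homomorphism `deg : W → ℚ` with `deg xᵢ = 1/pᵢ`; its
image is the subgroup `(1/m)ℤ` of `ℚ` where `m = lcm(p₀,…,pₙ)`, and its kernel is exactly
the torsion subgroup of `W`, so that there is an exact sequence
`0 → W_tors → W → (1/m)ℤ → 0`. -/
theorem degree_exact_sequence (n : ℕ) (p : Fin (n + 1) → ℕ) (hp : ∀ i, 2 ≤ p i) :
    ∃ deg : Wgrp n p →+ ℚ,
      (∀ i : Fin (n + 1), deg (Wx n p i) = 1 / (p i : ℚ)) ∧
      (deg.range : Set ℚ) = {q : ℚ | ∃ a : ℤ, q = (a : ℚ) / ((Finset.univ.lcm p : ℕ) : ℚ)} ∧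
      deg.ker = AddCommGroup.torsion (Wgrp n p) := by
  have hp0 : ∀ i, (p i : ℚ) ≠ 0 := fun i => by
    have := hp i
    exact_mod_cast (by omega : p i ≠ 0)
  let f : (Fin (n + 1) → ℤ) →+ ℚ :=
    { toFun := fun v => ∑ i, (v i : ℚ) / (p i : ℚ)
      map_zero' := by simp
      map_add' := fun v w => by simp [add_div, Finset.sum_add_distrib] }
  have fdef : ∀ v, f v = ∑ i, (v i : ℚ) / (p i : ℚ) := fun v => rfl
  have fsingle : ∀ i, f (Pi.single i 1) = 1 / (p i : ℚ) := fun i => by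
    rw [fdef, Finset.sum_eq_single i]
    · simp
    · intro j _ hj
      simp [Pi.single_eq_of_ne hj]
    · simp
  have hle : Wrel n p ≤ f.ker := by
    unfold Wrel
    rw [AddSubgroup.closure_le]
    rintro v ⟨i, rfl⟩
    rw [SetLike.mem_coe, AddMonoidHom.mem_ker, map_sub, map_zsmul, map_zsmul, fsingle, fsingle]
    have h0 := hp0 0
    have hi := hp0 i
    simp [h0, hi]
  obtain ⟨m, hm⟩ : ∃ m, m = Finset.univ.lcm p := ⟨_, rfl⟩
  rw [← hm]
  have hdvd : ∀ i, p i ∣ m := fun i => hm ▸ Finset.dvd_lcm (Finset.mem_univ i)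
  have hm0 : m ≠ 0 := by
    rw [hm, Ne, Finset.lcm_eq_zero_iff]
    rintro ⟨i, _, h⟩
    have := hp i
    omega
  have hmq : (m : ℚ) ≠ 0 := by exact_mod_cast hm0
  choose c hc using hdvd
  have fc : ∀ v, f v = ((∑ i, v i * (c i : ℤ) : ℤ) : ℚ) / (m : ℚ) := fun v => by
    rw [fdef]
    push_cast
    rw [Finset.sum_div]
    refine Finset.sum_congr rfl fun i _ => ?_
    rw [div_eq_div_iff (hp0 i) hmq]
    have : (m : ℚ) = p i * c i := by exact_mod_cast hc i
    rw [this]; ring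
  refine ⟨QuotientAddGroup.lift (Wrel n p) f hle, fun i => fsingle i, ?_, ?_⟩
  · obtain ⟨u, hu⟩ : ∃ u : Fin (n + 1) → ℤ, ∑ i, u i * (c i : ℤ) = 1 := by
      let I : Ideal ℤ := Ideal.span (Set.range fun i => (c i : ℤ))
      have hI : (1 : ℤ) ∈ I := by
        obtain ⟨g, hg⟩ := (IsPrincipalIdealRing.principal I).principal
        have hgc : ∀ i, g ∣ (c i : ℤ) := fun i => by
          have : (c i : ℤ) ∈ I := Ideal.subset_span ⟨i, rfl⟩
          rw [hg] at this
          exact Ideal.mem_span_singleton.1 this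
        have hgc' : ∀ i, g.natAbs ∣ c i := fun i => Int.natCast_dvd_natCast.1 (by
          simpa using hgc i)
        have hgm : g.natAbs ∣ m := (hgc' 0).trans ⟨p 0, by rw [hc 0, mul_comm]⟩
        obtain ⟨k, hk⟩ := hgm
        have hg0 : g.natAbs ≠ 0 := by
          intro h
          rw [h] at hk
          omega
        have hpk : m ∣ k := by
          conv_lhs => rw [hm]
          refine Finset.lcm_dvd fun i _ => ?_
          obtain ⟨d, hd⟩ := hgc' i
          refine ⟨d, Nat.eq_of_mul_eq_mul_left (Nat.pos_of_ne_zero hg0) ?_⟩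
          rw [← hk, hc i, hd]; ring
        have hk0 : 0 < k := Nat.pos_of_ne_zero (by rintro rfl; simp at hk; omega)
        have hmk := Nat.le_of_dvd hk0 hpk
        have : g.natAbs = 1 := by
          have : g.natAbs ≤ 1 := by
            by_contra! h
            nlinarith
          omega
        rw [hg]
        refine Ideal.mem_span_singleton.2 ?_
        exact (Int.isUnit_iff_natAbs_eq.2 this).dvd
      obtain ⟨u, hu⟩ := (Submodule.mem_span_range_iff_exists_fun ℤ).1 hI
      exact ⟨u, by simpa using hu⟩
    ext q
    constructor
    · rintro ⟨w, rfl⟩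
      obtain ⟨v, rfl⟩ := QuotientAddGroup.mk_surjective w
      exact ⟨_, fc v⟩
    · rintro ⟨a, rfl⟩
      refine ⟨QuotientAddGroup.mk (a • u), ?_⟩
      change f (a • u) = _
      rw [map_zsmul, fc, hu]
      simp [div_eq_mul_inv]
  · ext w
    obtain ⟨v, rfl⟩ := QuotientAddGroup.mk_surjective w
    rw [AddMonoidHom.mem_ker]
    constructor
    · intro h
      change f v = 0 at h
      rw [fc, div_eq_zero_iff] at h
      have h1 : ∑ i, v i * (c i : ℤ) = 0 := by
        rcases h with h | h
        · exact_mod_cast h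
        · exact absurd h hmq
      change IsOfFinAddOrder _
      rw [isOfFinAddOrder_iff_nsmul_eq_zero]
      refine ⟨m, Nat.pos_of_ne_zero hm0, ?_⟩
      rw [← QuotientAddGroup.mk_nsmul, QuotientAddGroup.eq_zero_iff]
      have key : ∑ i, (v i * (c i : ℤ)) • ((p 0 : ℤ) • Pi.single (0 : Fin (n + 1)) (1 : ℤ)
          - (p i : ℤ) • Pi.single i (1 : ℤ)) ∈ Wrel n p :=
        AddSubgroup.sum_mem _ fun i _ => AddSubgroup.zsmul_mem _ (by
          unfold Wrel
          exact AddSubgroup.subset_closure ⟨i, rfl⟩) _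
      have e : m • v = -∑ i, (v i * (c i : ℤ)) • ((p 0 : ℤ) • Pi.single (0 : Fin (n + 1)) (1 : ℤ)
          - (p i : ℤ) • Pi.single i (1 : ℤ)) := by
        simp only [smul_sub]
        rw [Finset.sum_sub_distrib, ← Finset.sum_smul, h1, zero_smul, zero_sub, neg_neg]
        ext j
        rw [Finset.sum_apply, Finset.sum_eq_single j]
        · have : (m : ℤ) = p j * c j := by exact_mod_cast hc j
          simp [this]; ring
        · intro i _ hi
          simp [Pi.single_eq_of_ne hi.symm]
        · simp
      rw [e]
      exact neg_mem key
    · intro h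
      change IsOfFinAddOrder _ at h
      obtain ⟨k, hk, h⟩ := isOfFinAddOrder_iff_nsmul_eq_zero.1 h
      have := congrArg (QuotientAddGroup.lift (Wrel n p) f hle) h
      rw [map_nsmul, map_zero] at this
      exact (smul_eq_zero.1 this).resolve_left hk.ne'
end

section
/- The torsion subgroup of W is isomorphic to the quotient group (∏_{j=0}^{n} ℤ/pⱼℤ)/⟨(1,1,…,1)⟩ of the product of the cyclic groups ℤ/pⱼℤ by the cyclic subgroup generated by the all-ones element (1,1,…,1). -/
/-- Weighted degree. -/
def wdeg {n : ℕ} (q : Fin (n + 1) → ℕ) : (Fin (n + 1) → ℤ) →+ ℤ where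
  toFun a := ∑ i, a i * (q i : ℤ)
  map_zero' := by simp
  map_add' a b := by simp [add_mul, Finset.sum_add_distrib]

lemma wdeg_apply {n : ℕ} (q : Fin (n + 1) → ℕ) (a : Fin (n + 1) → ℤ) :
    wdeg q a = ∑ i, a i * (q i : ℤ) := rfl

lemma mem_Wrel_iff {n : ℕ} (p q : Fin (n + 1) → ℕ) (P : ℕ) (hP : 0 < P)
    (hpq : ∀ i, p i * q i = P) (a : Fin (n + 1) → ℤ) :
    a ∈ Wrel n p ↔ wdeg q a = 0 ∧ ∀ i, (p i : ℤ) ∣ a i := by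
  have hpq' : ∀ i, (p i : ℤ) * (q i : ℤ) = P := fun i => by exact_mod_cast hpq i
  constructor
  · intro h
    refine AddSubgroup.closure_induction (p := fun a _ => wdeg q a = 0 ∧ ∀ i, (p i : ℤ) ∣ a i)
      ?_ ?_ ?_ ?_ h
    · rintro _ ⟨i, rfl⟩
      constructor
      · rw [map_sub, map_zsmul, map_zsmul]
        simp [wdeg_apply, Pi.single_apply, hpq']
      · intro j
        simp only [Pi.sub_apply, Pi.smul_apply, smul_eq_mul, Pi.single_apply]
        apply dvd_sub
        · split_ifs with h
          · subst h; simp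
          · simp
        · split_ifs with h
          · subst h; simp
          · simp
    · simp
    · rintro x y _ _ ⟨hx, hx'⟩ ⟨hy, hy'⟩
      exact ⟨by simp [hx, hy], fun i => dvd_add (hx' i) (hy' i)⟩
    · rintro x _ ⟨hx, hx'⟩
      exact ⟨by simp [hx], fun i => (dvd_neg.2 (hx' i))⟩
  · rintro ⟨h0, hd⟩
    choose b hb using hd
    have hs : ∑ i, b i = 0 := by
      have : (P : ℤ) * ∑ i, b i = 0 := by
        rw [← h0, wdeg_apply, Finset.mul_sum]
        refine Finset.sum_congr rfl fun i _ => ?_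
        rw [hb, ← hpq' i]; ring
      rcases mul_eq_zero.1 this with h | h
      · omega
      · exact h
    have ha : a = ∑ i, (-b i) • ((p 0 : ℤ) • Pi.single (0 : Fin (n + 1)) (1 : ℤ)
        - (p i : ℤ) • Pi.single i (1 : ℤ)) := by
      simp only [smul_sub, Finset.sum_sub_distrib, ← Finset.sum_smul, Finset.sum_neg_distrib, hs]
      ext j
      simp [Finset.sum_apply, Pi.single_apply, hb, mul_comm]
    rw [ha]
    refine AddSubgroup.sum_mem _ fun i _ => AddSubgroup.zsmul_mem _ ?_ _
    unfold Wrel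
    apply AddSubgroup.subset_closure
    exact ⟨i, rfl⟩

lemma mk_mem_torsion_iff {n : ℕ} (p q : Fin (n + 1) → ℕ) (P : ℕ) (hP : 0 < P)
    (hpq : ∀ i, p i * q i = P) (a : Fin (n + 1) → ℤ) :
    (QuotientAddGroup.mk' (Wrel n p) a) ∈ AddCommGroup.torsion (Wgrp n p) ↔ wdeg q a = 0 := by
  rw [AddCommGroup.mem_torsion, isOfFinAddOrder_iff_nsmul_eq_zero]
  have key : ∀ k : ℕ, k • (QuotientAddGroup.mk' (Wrel n p) a) = 0 ↔ k • a ∈ Wrel n p := by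
    intro k
    rw [← map_nsmul]
    exact QuotientAddGroup.eq_zero_iff _
  constructor
  · rintro ⟨k, hk, h⟩
    rw [key, mem_Wrel_iff p q P hP hpq, map_nsmul] at h
    have := h.1
    simp at this
    omega
  · intro h
    refine ⟨P, hP, ?_⟩
    rw [key, mem_Wrel_iff p q P hP hpq, map_nsmul, h]
    refine ⟨by simp, fun i => ?_⟩
    rw [← hpq i]
    simp [mul_assoc]

/-- Characters of the product of cyclic groups attached to integer vectors. -/
noncomputable def chr {n : ℕ} {A : Type} [AddCommGroup A] (p : Fin (n + 1) → ℕ)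
    (u : ∀ j, ZMod (p j) →+ A) : (Fin (n + 1) → ℤ) →+ ((∀ j, ZMod (p j)) →+ A) where
  toFun a := ∑ j, a j • (u j).comp (Pi.evalAddMonoidHom _ j)
  map_zero' := by simp
  map_add' a b := by simp [add_smul, Finset.sum_add_distrib]

lemma chr_apply {n : ℕ} {A : Type} [AddCommGroup A] (p : Fin (n + 1) → ℕ)
    (u : ∀ j, ZMod (p j) →+ A) (a : Fin (n + 1) → ℤ) (x : ∀ j, ZMod (p j)) :
    chr p u a x = ∑ j, a j • u j (x j) := by
  simp [chr, AddMonoidHom.finsetSum_apply]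

lemma torsion_iso_dual {n : ℕ} {A : Type} [AddCommGroup A] (p q : Fin (n + 1) → ℕ) (P : ℕ)
    (hP : 0 < P) (hpq : ∀ i, p i * q i = P) (z : A) (hz : ∀ k : ℤ, k • z = 0 ↔ (P : ℤ) ∣ k)
    (hA : ∀ j, ∀ t : A, p j • t = 0 → ∃ a : ℤ, t = a • (q j • z)) :
    Nonempty ((AddCommGroup.torsion (Wgrp n p)) ≃+
        (((∀ j : Fin (n + 1), ZMod (p j)) ⧸
          AddSubgroup.zmultiples (fun _ => 1 : ∀ j : Fin (n + 1), ZMod (p j))) →+ A)) := by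
  classical
  have hpq' : ∀ i, (p i : ℤ) * (q i : ℤ) = P := fun i => by exact_mod_cast hpq i
  have hq0 : ∀ i, (q i : ℤ) ≠ 0 := by
    intro i h
    have := hpq' i
    rw [h] at this
    simp at this
    omega
  have hu : ∀ j, ∃ u : ZMod (p j) →+ A, u 1 = (q j : ℤ) • z := by
    intro j
    refine ⟨ZMod.lift (p j) ⟨zmultiplesHom A ((q j : ℤ) • z), ?_⟩, ?_⟩
    · simp only [zmultiplesHom_apply, ← mul_smul, hpq']
      exact (hz _).2 dvd_rfl
    · have := ZMod.lift_coe (p j) ⟨zmultiplesHom A ((q j : ℤ) • z), by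
        simp only [zmultiplesHom_apply, ← mul_smul, hpq']
        exact (hz _).2 dvd_rfl⟩ 1
      simpa using this
  choose u hu1 using hu
  -- extensionality
  have hsingle : ∀ a j, chr p u a (Pi.single j 1) = (a j * (q j : ℤ)) • z := by
    intro a j
    rw [chr_apply, Finset.sum_eq_single j]
    · simp [hu1, mul_smul]
    · intro i _ hij
      simp [Pi.single_eq_of_ne hij]
    · simp
  have hone : ∀ a, chr p u a (fun _ => 1) = wdeg q a • z := by
    intro a
    rw [chr_apply, wdeg_apply, Finset.sum_smul]
    simp [hu1, mul_smul]
  have hext : ∀ f g : (∀ j, ZMod (p j)) →+ A, (∀ j, f (Pi.single j 1) = g (Pi.single j 1)) →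
      f = g := by
    intro f g h
    ext j x
    obtain ⟨k, rfl⟩ := ZMod.intCast_surjective x
    have e : (Pi.single j (k : ZMod (p j)) : ∀ j, ZMod (p j)) = k • Pi.single j 1 := by
      rw [← Pi.single_smul]; simp
    simp only [AddMonoidHom.comp_apply, AddMonoidHom.single_apply]
    rw [e, map_zsmul, map_zsmul, h j]
  let N := AddSubgroup.zmultiples (fun _ => 1 : ∀ j : Fin (n + 1), ZMod (p j))
  have hker : ∀ a : (wdeg q).ker, N ≤ (chr p u a.1).ker := by
    intro a
    rw [AddSubgroup.zmultiples_le]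
    show chr p u a.1 _ = 0
    rw [hone, AddMonoidHom.mem_ker.1 a.2, zero_smul]
  let ψ : (wdeg q).ker →+ (((∀ j, ZMod (p j)) ⧸ N) →+ A) :=
    AddMonoidHom.mk' (fun a => QuotientAddGroup.lift N (chr p u a.1) (hker a)) (by
      intro a b
      apply QuotientAddGroup.addMonoidHom_ext
      refine AddMonoidHom.ext fun x => ?_
      show chr p u (a.1 + b.1) x = chr p u a.1 x + chr p u b.1 x
      rw [map_add]; rfl)
  have hψ : ∀ a x, ψ a (QuotientAddGroup.mk' N x) = chr p u a.1 x := fun a x => rfl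
  let φ : (wdeg q).ker →+ AddCommGroup.torsion (Wgrp n p) :=
    ((QuotientAddGroup.mk' (Wrel n p)).comp (wdeg q).ker.subtype).codRestrict _
      (fun a => (mk_mem_torsion_iff p q P hP hpq a.1).2 a.2)
  have hφs : Function.Surjective φ := by
    rintro ⟨t, ht⟩
    obtain ⟨a, rfl⟩ := QuotientAddGroup.mk'_surjective _ t
    exact ⟨⟨a, (mk_mem_torsion_iff p q P hP hpq a).1 ht⟩, rfl⟩
  have hψs : Function.Surjective ψ := by
    intro f
    have h1 : ∀ j, ∃ a : ℤ, f (QuotientAddGroup.mk' N (Pi.single j 1)) = a • (q j • z) := by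
      intro j
      apply hA
      rw [← map_nsmul, ← map_nsmul, ← Pi.single_smul]
      simp
    choose a ha using h1
    have hfa : f.comp (QuotientAddGroup.mk' N) = chr p u a := by
      apply hext
      intro j
      rw [hsingle, AddMonoidHom.comp_apply, ha, mul_smul, natCast_zsmul]
    have hdvd : (P : ℤ) ∣ wdeg q a := by
      rw [← hz, ← hone, ← hfa, AddMonoidHom.comp_apply]
      have : QuotientAddGroup.mk' N (fun _ => 1) = 0 :=
        (QuotientAddGroup.eq_zero_iff _).2 (AddSubgroup.mem_zmultiples _)
      rw [this, map_zero]
    obtain ⟨m, hm⟩ := hdvd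
    have hb : wdeg q (a - Pi.single 0 (m * p 0)) = 0 := by
      rw [map_sub, hm, wdeg_apply, Finset.sum_eq_single 0]
      · rw [← hpq' 0]; simp; ring
      · intro i _ hi
        simp [Pi.single_eq_of_ne hi]
      · simp
    refine ⟨⟨_, hb⟩, ?_⟩
    apply QuotientAddGroup.addMonoidHom_ext
    rw [hfa]
    apply hext
    intro j
    rw [AddMonoidHom.comp_apply, hψ, hsingle, hsingle, ← sub_eq_zero, ← sub_smul, hz]
    by_cases hj : j = 0
    · subst hj
      rw [← hpq' 0]
      exact ⟨-m, by simp; ring⟩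
    · simp [Pi.single_eq_of_ne hj]
  have hk : φ.ker = ψ.ker := by
    ext a
    have h1 : a ∈ φ.ker ↔ a.1 ∈ Wrel n p := by
      rw [AddMonoidHom.mem_ker, ← QuotientAddGroup.eq_zero_iff]
      exact Subtype.ext_iff
    have h2 : a ∈ ψ.ker ↔ ∀ j, (p j : ℤ) ∣ a.1 j := by
      have h3 : a ∈ ψ.ker ↔ ∀ j, chr p u a.1 (Pi.single j 1) = 0 := by
        rw [AddMonoidHom.mem_ker]
        constructor
        · intro h j
          rw [← hψ, h]; rfl
        · intro h
          apply QuotientAddGroup.addMonoidHom_ext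
          apply hext
          intro j
          exact h j
      rw [h3]
      refine forall_congr' fun j => ?_
      rw [hsingle, hz, ← hpq' j]
      exact mul_dvd_mul_iff_right (hq0 j)
    rw [h1, h2, mem_Wrel_iff p q P hP hpq]
    exact and_iff_right a.2
  exact ⟨(QuotientAddGroup.quotientKerEquivOfSurjective φ hφs).symm.trans
    ((QuotientAddGroup.quotientAddEquivOfEq hk).trans
      (QuotientAddGroup.quotientKerEquivOfSurjective ψ hψs))⟩

/-- The torsion subgroup of `W` is isomorphic to the quotient of `∏ⱼ ℤ/pⱼℤ` by the cyclic
subgroup generated by the all-ones element `(1,1,…,1)`. -/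
theorem torsion_subgroup_iso (n : ℕ) (p : Fin (n + 1) → ℕ) (hp : ∀ i, 2 ≤ p i) :
    Nonempty
      ((AddCommGroup.torsion (Wgrp n p)) ≃+
        ((∀ j : Fin (n + 1), ZMod (p j)) ⧸
          AddSubgroup.zmultiples (fun _ => 1 : ∀ j : Fin (n + 1), ZMod (p j)))) := by
  have hne : ∀ i, NeZero (p i) := fun i => ⟨by have := hp i; omega⟩
  let P := ∏ i, p i
  have hP : 0 < P := Finset.prod_pos fun i _ => by have := hp i; omega
  have hdvd : ∀ i, ∃ q, P = p i * q := fun i => Finset.dvd_prod_of_mem p (Finset.mem_univ i)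
  choose q hq using hdvd
  have hζ' := Complex.isPrimitiveRoot_exp P hP.ne'
  have hζ := hζ'.isUnit_unit hP.ne'
  set ζ : ℂˣ := (hζ'.isUnit hP.ne').unit
  obtain ⟨e1⟩ := torsion_iso_dual (A := Additive ℂˣ) p q P hP (fun i => (hq i).symm)
    (Additive.ofMul ζ) (fun k => by
      rw [← ofMul_zpow, ← hζ.zpow_eq_one_iff_dvd]
      exact Iff.rfl) (fun j t ht => by
      have h1 : IsPrimitiveRoot (ζ ^ q j) (p j) := hζ.pow hP (by rw [hq j, mul_comm])
      have h2 : t.toMul ∈ rootsOfUnity (p j) ℂ := ht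
      rw [← h1.zpowers_eq] at h2
      obtain ⟨a, ha⟩ := h2
      exact ⟨a, ha.symm⟩)
  let Q := ((∀ j : Fin (n + 1), ZMod (p j)) ⧸
          AddSubgroup.zmultiples (fun _ => 1 : ∀ j : Fin (n + 1), ZMod (p j)))
  have : Finite Q := inferInstance
  obtain ⟨e2⟩ := CommGroup.monoidHom_mulEquiv_of_hasEnoughRootsOfUnity (Multiplicative Q) ℂ
  refine ⟨e1.trans ?_⟩
  refine AddEquiv.mk' ((AddMonoidHom.toMultiplicativeLeft (α := Q) (β := ℂˣ)).trans
    (e2.toEquiv.trans Multiplicative.toAdd)) ?_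
  intro f g
  exact congrArg Multiplicative.toAdd (e2.map_mul (AddMonoidHom.toMultiplicativeLeft f)
    (AddMonoidHom.toMultiplicativeLeft g))
end

section
/- The group Hom(π₁, ℂˣ) of group homomorphisms from π₁ to the multiplicative group of nonzero complex numbers, under pointwise multiplication, is isomorphic to the quotient group (∏_{j=0}^{n} ℤ/pⱼℤ)/⟨(1,1,…,1)⟩ of the product of the cyclic groups ℤ/pⱼℤ by the cyclic subgroup generated by the all-ones element (1,1,…,1). -/
/-- The relators `γⱼ^{pⱼ}` (for each `j`) and `γ₀γ₁⋯γₙ` defining the orbifold fundamental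
group of an orbifold line of signature `(p₀,…,pₙ)`. -/
def pi1Rels (n : ℕ) (p : Fin (n + 1) → ℕ) : Set (FreeGroup (Fin (n + 1))) :=
  {r | ∃ j : Fin (n + 1), r = FreeGroup.of j ^ p j} ∪
    {(List.ofFn fun j : Fin (n + 1) => FreeGroup.of j).prod}

/-- The group `π₁` presented by generators `γ₀,…,γₙ` with relations `γⱼ^{pⱼ} = 1` and
`γ₀γ₁⋯γₙ = 1`. -/
abbrev pi1 (n : ℕ) (p : Fin (n + 1) → ℕ) : Type :=
  PresentedGroup (pi1Rels n p)

/-- The group `Hom(π₁, ℂˣ)` (under pointwise multiplication) is isomorphic to the quotient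
of `∏ⱼ ℤ/pⱼℤ` by the cyclic subgroup generated by the all-ones element `(1,1,…,1)`. -/
theorem characters_of_pi1 (n : ℕ) (p : Fin (n + 1) → ℕ) (hp : ∀ i, 2 ≤ p i) :
    Nonempty
      ((pi1 n p →* ℂˣ) ≃*
        Multiplicative
          ((∀ j : Fin (n + 1), ZMod (p j)) ⧸
            AddSubgroup.zmultiples (fun _ => 1 : ∀ j : Fin (n + 1), ZMod (p j)))) := by
  classical
  have hne : ∀ i, NeZero (p i) := fun i => ⟨by have := hp i; omega⟩
  set Z := AddSubgroup.zmultiples (fun _ => 1 : ∀ j : Fin (n + 1), ZMod (p j)) with hZ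
  have hfin : Finite (Multiplicative ((∀ j : Fin (n + 1), ZMod (p j)) ⧸ Z)) :=
    inferInstanceAs (Finite ((∀ j : Fin (n + 1), ZMod (p j)) ⧸ Z))
  let v : Fin (n + 1) → Multiplicative ((∀ j : Fin (n + 1), ZMod (p j)) ⧸ Z) :=
    fun j => Multiplicative.ofAdd (QuotientAddGroup.mk' Z (Pi.single j 1))
  have hv : ∀ r ∈ pi1Rels n p, FreeGroup.lift v r = 1 := by
    rintro r (⟨j, rfl⟩ | hr)
    · rw [map_pow, FreeGroup.lift_apply_of]
      simp only [v]
      rw [← ofAdd_nsmul, ← map_nsmul, ← Pi.single_smul]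
      simp
    · rw [Set.mem_singleton_iff.1 hr, map_list_prod, List.map_ofFn, List.prod_ofFn]
      simp only [Function.comp_apply, FreeGroup.lift_apply_of, v]
      rw [← ofAdd_sum, ← map_sum, Finset.univ_sum_single (fun _ => 1 : ∀ j, ZMod (p j)),
        ofAdd_eq_one]
      exact (QuotientAddGroup.eq_zero_iff _).2 (AddSubgroup.mem_zmultiples _)
  let f := PresentedGroup.toGroup hv
  have hfof : ∀ j, f (PresentedGroup.of j) = v j := fun j => PresentedGroup.toGroup.of hv
  let Φ : (Multiplicative ((∀ j : Fin (n + 1), ZMod (p j)) ⧸ Z) →* ℂˣ) →* (pi1 n p →* ℂˣ) :=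
    MonoidHom.compHom' f
  have hΦ : Function.Bijective Φ := by
    constructor
    · intro a b hab
      have h1 : ∀ j, a (v j) = b (v j) := fun j => by
        have := DFunLike.congr_fun hab (PresentedGroup.of j)
        simpa [Φ, hfof] using this
      have h2 : (MonoidHom.toAdditiveRight a) = MonoidHom.toAdditiveRight b := by
        apply QuotientAddGroup.addMonoidHom_ext
        apply AddMonoidHom.functions_ext'
        intro j
        refine AddMonoidHom.ext fun x => ?_
        obtain ⟨k, rfl⟩ := ZMod.intCast_surjective x
        rw [← zsmul_one k, map_zsmul, map_zsmul]
        exact congrArg (fun t : ℂˣ => k • Additive.ofMul t) (h1 j)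
      exact MonoidHom.toAdditiveRight.injective h2
    · intro φ
      have hpow : ∀ j, φ (PresentedGroup.of j) ^ p j = 1 := by
        intro j
        have : PresentedGroup.mk (pi1Rels n p) (FreeGroup.of j ^ p j) = 1 :=
          PresentedGroup.one_of_mem (Or.inl ⟨j, rfl⟩)
        have h := congrArg φ this
        rwa [map_pow, map_pow, map_one] at h
      have hprod : ∏ j, φ (PresentedGroup.of j) = 1 := by
        have : PresentedGroup.mk (pi1Rels n p)
            (List.ofFn fun j : Fin (n + 1) => FreeGroup.of j).prod = 1 :=
          PresentedGroup.one_of_mem (Or.inr rfl)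
        have h := congrArg φ this
        rw [map_list_prod, map_list_prod, List.map_ofFn, List.map_ofFn, List.prod_ofFn,
          map_one] at h
        exact h
      let L : ∀ j, ZMod (p j) →+ Additive ℂˣ := fun j =>
        ZMod.lift (p j) ⟨zmultiplesHom _ (Additive.ofMul (φ (PresentedGroup.of j))), by
          rw [zmultiplesHom_apply, natCast_zsmul, ← ofMul_pow, hpow, ofMul_one]⟩
      have hL : ∀ j, L j 1 = Additive.ofMul (φ (PresentedGroup.of j)) := by
        intro j
        have := ZMod.lift_coe (p j) ⟨zmultiplesHom _ (Additive.ofMul (φ (PresentedGroup.of j))), by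
          rw [zmultiplesHom_apply, natCast_zsmul, ← ofMul_pow, hpow, ofMul_one]⟩ 1
        simpa [L] using this
      let g : (∀ j, ZMod (p j)) →+ Additive ℂˣ :=
        ∑ j, (L j).comp (Pi.evalAddMonoidHom (fun j => ZMod (p j)) j)
      have hg : ∀ x, g x = ∑ j, L j (x j) := fun x => by simp [g]
      have hgZ : Z ≤ g.ker := by
        rw [hZ, AddSubgroup.zmultiples_le, AddMonoidHom.mem_ker, hg]
        simp only [hL]
        rw [← ofMul_prod, hprod, ofMul_one]
      refine ⟨AddMonoidHom.toMultiplicativeLeft (QuotientAddGroup.lift Z g hgZ), ?_⟩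
      apply PresentedGroup.ext
      intro j
      have h3 : g (Pi.single j 1) = Additive.ofMul (φ (PresentedGroup.of j)) := by
        rw [hg, Finset.sum_eq_single j, Pi.single_eq_same, hL]
        · intro k _ hk
          rw [Pi.single_eq_of_ne hk, map_zero]
        · simp
      have h4 : Φ (AddMonoidHom.toMultiplicativeLeft (QuotientAddGroup.lift Z g hgZ))
          (PresentedGroup.of j) = AddMonoidHom.toMultiplicativeLeft
            (QuotientAddGroup.lift Z g hgZ) (v j) := by
        rw [← hfof]; rfl
      rw [h4]
      exact congrArg Additive.toMul h3
  have e := MulEquiv.ofBijective Φ hΦ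
  have : NeZero (Monoid.exponent (Multiplicative ((∀ j : Fin (n + 1), ZMod (p j)) ⧸ Z))) :=
    ⟨Monoid.exponent_ne_zero_of_finite⟩
  obtain ⟨d⟩ := CommGroup.monoidHom_mulEquiv_of_hasEnoughRootsOfUnity
    (Multiplicative ((∀ j : Fin (n + 1), ZMod (p j)) ⧸ Z)) ℂ
  exact ⟨e.symm.trans d⟩
end

section
/- Let φ: G → ℂˣ be any group homomorphism, and let t ∈ {0,1,2,3} be the number of free factors on which φ is trivial, i.e. t = (1 if φ(s₀) = 1) + (1 if φ(s₁) = 1) + (1 if φ(r) = 1). Then the first group cohomology H¹(G, ℂ_φ) is a complex vector space of dimension 2 − t if φ is nontrivial, and of dimension 0 if φ is trivial. -/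
noncomputable section

/-- The one-dimensional representation `ℂ_φ` attached to a character `φ : G → ℂˣ`,
in which `g` acts on `ℂ` by multiplication by `φ(g)`. -/
def repOfChar {G : Type} [Group G] (φ : G →* ℂˣ) : Rep ℂ G :=
  Rep.of ((Algebra.lmul ℂ ℂ).toRingHom.toMonoidHom.comp ((Units.coeHom ℂ).comp φ))

/-- `G = C₂ * C₂ * C₃`, the free product of two cyclic groups of order 2 and one cyclic
group of order 3. -/
abbrev G223 : Type := Monoid.CoprodI (fun i : Fin 3 => Multiplicative (ZMod (![2, 2, 3] i)))

/-- The generators `s₀, s₁` (of order 2) and `r` (of order 3) of `G = C₂ * C₂ * C₃`. -/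
def gen223 (i : Fin 3) : G223 :=
  Monoid.CoprodI.of (i := i) (Multiplicative.ofAdd (1 : ZMod (![2, 2, 3] i)))

/-- scalar cocycle condition -/
def IsCoc {G : Type} [Group G] (φ : G →* ℂˣ) (f : G → ℂ) : Prop :=
  ∀ g h, f (g * h) = (φ g : ℂ) * f h + f g

lemma IsCoc.one {G : Type} [Group G] {φ : G →* ℂˣ} {f : G → ℂ} (hf : IsCoc φ f) : f 1 = 0 := by
  have := hf 1 1
  simpa using this

lemma IsCoc.pow {G : Type} [Group G] {φ : G →* ℂˣ} {f : G → ℂ} (hf : IsCoc φ f) (g : G) (z : ℂ)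
    (h : f g = ((φ g : ℂ) - 1) * z) (k : ℕ) : f (g ^ k) = ((φ (g ^ k) : ℂ) - 1) * z := by
  induction k with
  | zero => simp [hf.one]
  | succ k ih =>
    rw [pow_succ, hf, ih, h]
    simp only [map_mul, Units.val_mul]
    ring

lemma IsCoc.pow_triv {G : Type} [Group G] {φ : G →* ℂˣ} {f : G → ℂ} (hf : IsCoc φ f) (g : G)
    (h : φ g = 1) (k : ℕ) : f (g ^ k) = k * f g := by
  induction k with
  | zero => simp [hf.one]
  | succ k ih =>
    rw [pow_succ, hf, ih]
    simp [h]
    ring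

lemma coc_mem {G : Type} [Group G] (φ : G →* ℂˣ) (f : G → ℂ) :
    (show G → repOfChar φ from f) ∈ groupCohomology.cocycles₁ (repOfChar φ) ↔ IsCoc φ f := by
  rw [groupCohomology.mem_cocycles₁_iff]
  exact Iff.rfl

lemma cob_mem {G : Type} [Group G] (φ : G →* ℂˣ) (f : G → ℂ) :
    (show G → repOfChar φ from f) ∈ groupCohomology.coboundaries₁ (repOfChar φ) ↔
      ∃ z : ℂ, ∀ g, f g = ((φ g : ℂ) - 1) * z := by
  constructor
  · rintro ⟨z, hz⟩
    refine ⟨z, fun g => ?_⟩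
    have h2 : ∀ w : ℂ, (φ g : ℂ) * w - w = f g → f g = ((φ g : ℂ) - 1) * w := by
      intro w hw
      rw [← hw]; ring
    exact h2 z (congrFun hz g)
  · rintro ⟨z, hz⟩
    refine ⟨z, funext fun g => ?_⟩
    change (φ g : ℂ) * z - z = f g
    rw [hz]; ring

instance nz223 (i : Fin 3) : NeZero (![2, 2, 3] i : ℕ) := by
  constructor
  fin_cases i <;> simp

lemma of_eq_pow (i : Fin 3) (x : Multiplicative (ZMod (![2, 2, 3] i))) :
    (Monoid.CoprodI.of x : G223) = gen223 i ^ (x.toAdd.val) := by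
  rw [gen223, ← map_pow, ← ofAdd_nsmul]
  congr 1
  simp

lemma gen_pow (i : Fin 3) : gen223 i ^ (![2, 2, 3] i : ℕ) = 1 := by
  rw [gen223, ← map_pow, ← ofAdd_nsmul]
  simp

lemma coc_ext {φ : G223 →* ℂˣ} {f f' : G223 → ℂ} (hf : IsCoc φ f) (hf' : IsCoc φ f')
    (h : ∀ (i : Fin 3) (x : Multiplicative (ZMod (![2, 2, 3] i))),
      f (Monoid.CoprodI.of x) = f' (Monoid.CoprodI.of x)) (g : G223) : f g = f' g := by
  induction g using Monoid.CoprodI.induction_on with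
  | one => rw [hf.one, hf'.one]
  | of i m => exact h i m
  | mul x y hx hy => rw [hf, hf', hx, hy]

/-- affine action attached to `c` -/
def affHom (φ : G223 →* ℂˣ) (c : Fin 3 → ℂ) : G223 →* Function.End ℂ :=
  Monoid.CoprodI.lift fun i =>
    { toFun := fun x z => (φ (Monoid.CoprodI.of x) : ℂ) * z + ((φ (Monoid.CoprodI.of x) : ℂ) - 1) * c i
      map_one' := by
        funext z
        change _ = z
        simp
      map_mul' := by
        intro x y
        funext z
        change _ = (φ (Monoid.CoprodI.of x) : ℂ) * ((φ (Monoid.CoprodI.of y) : ℂ) * z +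
          ((φ (Monoid.CoprodI.of y) : ℂ) - 1) * c i) + ((φ (Monoid.CoprodI.of x) : ℂ) - 1) * c i
        simp only [map_mul, Units.val_mul]
        ring }

lemma affHom_of (φ : G223 →* ℂˣ) (c : Fin 3 → ℂ) (i : Fin 3)
    (x : Multiplicative (ZMod (![2, 2, 3] i))) (z : ℂ) :
    affHom φ c (Monoid.CoprodI.of x) z = (φ (Monoid.CoprodI.of x) : ℂ) * z +
      ((φ (Monoid.CoprodI.of x) : ℂ) - 1) * c i := by
  rw [affHom, Monoid.CoprodI.lift_of]
  rfl

/-- the cocycle attached to `c` -/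
def cocFun (φ : G223 →* ℂˣ) (c : Fin 3 → ℂ) (g : G223) : ℂ := affHom φ c g (0 : ℂ)

lemma cocFun_of (φ : G223 →* ℂˣ) (c : Fin 3 → ℂ) (i : Fin 3)
    (x : Multiplicative (ZMod (![2, 2, 3] i))) :
    cocFun φ c (Monoid.CoprodI.of x) = ((φ (Monoid.CoprodI.of x) : ℂ) - 1) * c i := by
  rw [cocFun, affHom_of]
  ring

lemma affHom_apply (φ : G223 →* ℂˣ) (c : Fin 3 → ℂ) (g : G223) :
    ∀ z : ℂ, affHom φ c g z = (φ g : ℂ) * z + affHom φ c g (0 : ℂ) := by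
  induction g using Monoid.CoprodI.induction_on with
  | one => intro z; simp [Function.End.one_def]
  | of i m => intro z; rw [affHom_of, affHom_of]; ring
  | mul x y hx hy =>
    intro z
    rw [map_mul]
    change affHom φ c x (affHom φ c y z) = _ + affHom φ c x (affHom φ c y (0 : ℂ))
    rw [hx, hy, hx (affHom φ c y (0 : ℂ))]
    simp only [map_mul, Units.val_mul]
    ring

lemma cocFun_isCoc (φ : G223 →* ℂˣ) (c : Fin 3 → ℂ) : IsCoc φ (cocFun φ c) := by
  intro g h
  unfold cocFun
  rw [map_mul]
  change affHom φ c g (affHom φ c h (0 : ℂ)) = _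
  rw [affHom_apply]

lemma exists_cocFun (φ : G223 →* ℂˣ) (f : G223 → ℂ) (hf : IsCoc φ f) :
    f = cocFun φ (fun i => f (gen223 i) / ((φ (gen223 i) : ℂ) - 1)) := by
  funext g
  refine coc_ext hf (cocFun_isCoc _ _) (fun i x => ?_) g
  rw [cocFun_of, of_eq_pow]
  apply hf.pow
  by_cases h : φ (gen223 i) = 1
  · have h1 := hf.pow_triv _ h (![2, 2, 3] i)
    rw [gen_pow, hf.one] at h1
    have h2 : ((![2, 2, 3] i : ℕ) : ℂ) ≠ 0 := Nat.cast_ne_zero.2 (NeZero.ne _)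
    have h3 : f (gen223 i) = 0 := by
      rcases mul_eq_zero.1 h1.symm with h4 | h4
      · exact absurd h4 h2
      · exact h4
    simp [h3]
  · have : (φ (gen223 i) : ℂ) - 1 ≠ 0 := by
      rw [sub_ne_zero]
      exact fun h' => h (Units.ext h')
    field_simp

/-- cocycles are parametrized linearly -/
def cocLin (φ : G223 →* ℂˣ) :
    (Fin 3 → ℂ) →ₗ[ℂ] groupCohomology.cocycles₁ (repOfChar φ) where
  toFun c := ⟨cocFun φ c, (coc_mem φ _).2 (cocFun_isCoc φ c)⟩
  map_add' c d := by
    apply Subtype.ext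
    funext g
    change cocFun φ (c + d) g = cocFun φ c g + cocFun φ d g
    refine coc_ext (f' := fun g => cocFun φ c g + cocFun φ d g) (cocFun_isCoc _ _) ?_ ?_ g
    · intro g h
      simp only [cocFun_isCoc φ _ g h]
      ring
    · intro i x
      simp only [cocFun_of, Pi.add_apply]
      ring
  map_smul' a c := by
    apply Subtype.ext
    funext g
    change cocFun φ (a • c) g = a * cocFun φ c g
    refine coc_ext (f' := fun g => a * cocFun φ c g) (cocFun_isCoc _ _) ?_ ?_ g
    · intro g h
      simp only [cocFun_isCoc φ _ g h]
      ring
    · intro i x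
      simp only [cocFun_of, Pi.smul_apply, smul_eq_mul]
      ring

/-- the parametrization of `H¹` -/
def h1Lin (φ : G223 →* ℂˣ) : ({i : Fin 3 // φ (gen223 i) ≠ 1} → ℂ) →ₗ[ℂ]
    groupCohomology.H1 (repOfChar φ) :=
  (groupCohomology.H1π (repOfChar φ)).hom ∘ₗ cocLin φ ∘ₗ
    Function.ExtendByZero.linearMap ℂ (Subtype.val : {i : Fin 3 // φ (gen223 i) ≠ 1} → Fin 3)

lemma cocFun_congr (φ : G223 →* ℂˣ) (c d : Fin 3 → ℂ)
    (h : ∀ i, φ (gen223 i) ≠ 1 → c i = d i) : cocFun φ c = cocFun φ d := by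
  funext g
  refine coc_ext (cocFun_isCoc _ _) (cocFun_isCoc _ _) (fun i x => ?_) g
  rw [cocFun_of, cocFun_of]
  by_cases hi : φ (gen223 i) = 1
  · simp [of_eq_pow, hi]
  · rw [h i hi]

lemma ext_key (φ : G223 →* ℂˣ) (v : {i : Fin 3 // φ (gen223 i) ≠ 1} → ℂ)
    (i : {i : Fin 3 // φ (gen223 i) ≠ 1}) :
    Function.ExtendByZero.linearMap ℂ Subtype.val v i.1 = v i :=
  Subtype.val_injective.extend_apply _ _ i

lemma h1Lin_surj (φ : G223 →* ℂˣ) : Function.Surjective (h1Lin φ) := by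
  intro y
  induction y using groupCohomology.H1_induction_on with
  | h f =>
  have hf : IsCoc φ f.1 := (coc_mem φ _).1 f.2
  refine ⟨fun i => (show ℂ from f.1 (gen223 i)) / ((φ (gen223 i) : ℂ) - 1), ?_⟩
  unfold h1Lin
  simp only [LinearMap.comp_apply]
  congr 1
  apply Subtype.ext
  refine Eq.trans ?_ (exists_cocFun φ f.1 hf).symm
  apply cocFun_congr
  intro i hi
  exact ext_key φ _ ⟨i, hi⟩

lemma h1Lin_ker (φ : G223 →* ℂˣ) :
    LinearMap.ker (h1Lin φ) = Submodule.span ℂ {fun _ => (1 : ℂ)} := by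
  ext v
  rw [LinearMap.mem_ker, Submodule.mem_span_singleton]
  unfold h1Lin
  simp only [LinearMap.comp_apply]
  refine (groupCohomology.H1π_eq_zero_iff _).trans ?_
  refine (cob_mem φ (cocFun φ (Function.ExtendByZero.linearMap ℂ Subtype.val v))).trans ?_
  have key : ∀ i : {i : Fin 3 // φ (gen223 i) ≠ 1},
      Function.ExtendByZero.linearMap ℂ Subtype.val v i.1 = v i :=
    fun i => Subtype.val_injective.extend_apply _ _ i
  constructor
  · rintro ⟨z, hz⟩
    refine ⟨z, funext fun i => ?_⟩
    have h1 := hz (gen223 i.1)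
    have h2 : (φ (gen223 i.1) : ℂ) - 1 ≠ 0 := by
      rw [sub_ne_zero]
      exact fun h' => i.2 (Units.ext h')
    rw [gen223, cocFun_of, ← gen223, key] at h1
    simpa using (mul_left_cancel₀ h2 h1).symm
  · rintro ⟨z, rfl⟩
    refine ⟨z, fun g => ?_⟩
    rw [cocFun_congr φ _ (fun _ => z)]
    · refine coc_ext (f' := fun g => ((φ g : ℂ) - 1) * z) (cocFun_isCoc _ _) ?_ ?_ g
      · intro g h
        simp only [map_mul, Units.val_mul]
        ring
      · intro i x
        rw [cocFun_of]
    · intro i hi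
      have := key ⟨i, hi⟩
      simpa using this

lemma char_eq_one (φ : G223 →* ℂˣ) : φ = 1 ↔ ∀ i, φ (gen223 i) = 1 := by
  constructor
  · rintro rfl i; rfl
  · intro h
    refine Monoid.CoprodI.ext_hom _ _ fun i => MonoidHom.ext fun x => ?_
    simp [of_eq_pow, h]

open scoped Classical in
/-- For a character `φ : G → ℂˣ` of `G = C₂ * C₂ * C₃`, letting `t` be the number of
free factors on which `φ` is trivial, `H¹(G, ℂ_φ)` has dimension `2 − t` if `φ` is
nontrivial, and dimension `0` if `φ` is trivial. -/
theorem h1_dimension_of_character (φ : G223 →* ℂˣ)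
    (t : ℕ) (ht : t = (Finset.univ.filter fun i : Fin 3 => φ (gen223 i) = 1).card) :
    (φ ≠ 1 → Module.rank ℂ (groupCohomology.H1 (repOfChar φ)) = ((2 - t : ℕ) : Cardinal)) ∧
    (φ = 1 → Module.rank ℂ (groupCohomology.H1 (repOfChar φ)) = 0) := by
  have hsurj := h1Lin_surj φ
  have hfin : Module.Finite ℂ (groupCohomology.H1 (repOfChar φ)) :=
    Module.Finite.of_surjective (h1Lin φ) hsurj
  have hrk := LinearMap.finrank_range_add_finrank_ker (h1Lin φ)
  rw [LinearMap.range_eq_top.2 hsurj, finrank_top, h1Lin_ker, Module.finrank_fintype_fun_eq_card]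
    at hrk
  have hcard : Fintype.card {i : Fin 3 // φ (gen223 i) ≠ 1} + t = 3 := by
    rw [ht, Fintype.card_subtype, add_comm, Finset.card_filter_add_card_filter_not]
    simp
  rw [← Module.finrank_eq_rank]
  constructor
  · intro h
    have hne : ∃ i, φ (gen223 i) ≠ 1 := by
      by_contra! hc
      exact h ((char_eq_one φ).2 hc)
    obtain ⟨i, hi⟩ := hne
    rw [finrank_span_singleton (fun h0 => one_ne_zero (congrFun h0 ⟨i, hi⟩))] at hrk
    congr 1
    omega
  · intro h
    have h1 := (char_eq_one φ).1 h
    have : Fintype.card {i : Fin 3 // φ (gen223 i) ≠ 1} = 0 := by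
      rw [Fintype.card_eq_zero_iff]
      exact ⟨fun i => i.2 (h1 i.1)⟩
    have : Module.finrank ℂ (groupCohomology.H1 (repOfChar φ)) = 0 := by omega
    rw [this]; simp
end
end

section
/- Let χ: G → ℂˣ be the homomorphism with χ(s₀) = χ(s₁) = χ(s₂) = −1. Then the first group cohomology H¹(G, ℂ_χ) is a complex vector space of dimension 2. -/
noncomputable section

/-- `G = C₂ * C₂ * C₂`, the free product of three cyclic groups of order 2. -/
abbrev G222 : Type := Monoid.CoprodI (fun _ : Fin 3 => Multiplicative (ZMod 2))

/-- The generators `s₀, s₁, s₂` (each of order 2) of `G = C₂ * C₂ * C₂`. -/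
def gen222 (i : Fin 3) : G222 :=
  Monoid.CoprodI.of (i := i) (Multiplicative.ofAdd (1 : ZMod 2))

theorem G222_ind {p : G222 → Prop} (h1 : p 1) (hg : ∀ i, p (gen222 i))
    (hm : ∀ x y, p x → p y → p (x * y)) (g : G222) : p g := by
  induction g using Monoid.CoprodI.induction_on with
  | one => exact h1
  | of i m =>
    have : m = 1 ∨ m = Multiplicative.ofAdd (1 : ZMod 2) := by
      revert m; decide
    rcases this with rfl | rfl
    · simpa using h1
    · exact hg i
  | mul x y hx hy => exact hm x y hx hy

def flip222 (a : ℂ) : Equiv.Perm ℂ where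
  toFun x := a - x
  invFun x := a - x
  left_inv x := by ring
  right_inv x := by ring

def flipHom222 (a : ℂ) : Multiplicative (ZMod 2) →* Equiv.Perm ℂ :=
  MonoidHom.mk' (fun z => if z = 1 then 1 else flip222 a) (by
    have hf : flip222 a * flip222 a = 1 := by
      ext x
      simp [flip222]
    have key : ∀ m : Multiplicative (ZMod 2),
        m = 1 ∨ m = Multiplicative.ofAdd (1 : ZMod 2) := by decide
    have e1 : (Multiplicative.ofAdd (1 : ZMod 2)) ≠ 1 := by decide
    have e2 : (Multiplicative.ofAdd (1 : ZMod 2)) * Multiplicative.ofAdd (1 : ZMod 2) = 1 := by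
      decide
    intro x y
    rcases key x with rfl | rfl <;> rcases key y with rfl | rfl
    · simp
    · simp
    · simp
    · rw [e2]; simp only [if_true, if_neg e1, hf])

def aff222 (a : Fin 3 → ℂ) : G222 →* Equiv.Perm ℂ :=
  Monoid.CoprodI.lift (fun i => flipHom222 (a i))

theorem aff222_gen (a : Fin 3 → ℂ) (i : Fin 3) (x : ℂ) : aff222 a (gen222 i) x = a i - x := by
  have e1 : (Multiplicative.ofAdd (1 : ZMod 2)) ≠ 1 := by decide
  unfold aff222 gen222
  rw [Monoid.CoprodI.lift_of]
  simp only [flipHom222, MonoidHom.mk'_apply, if_neg e1]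
  rfl

theorem aff222_apply (χ : G222 →* ℂˣ) (hχ : ∀ i : Fin 3, χ (gen222 i) = -1)
    (a : Fin 3 → ℂ) (g : G222) : ∀ x, aff222 a g x = χ g * x + aff222 a g 0 := by
  induction g using G222_ind with
  | h1 => simp
  | hg i => intro x; simp [aff222_gen, hχ]; ring
  | hm g h hg hh =>
    intro x
    simp only [map_mul, Equiv.Perm.mul_apply, Units.val_mul]
    rw [hg, hh x, hg (aff222 a h 0)]; ring

theorem repOfChar_rho (χ : G222 →* ℂˣ) (g : G222) (x : ℂ) :
    (repOfChar χ).ρ g x = (χ g : ℂ) * x := rfl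

open groupCohomology

theorem mem_coc (χ : G222 →* ℂˣ) (f : G222 → ℂ) :
    f ∈ cocycles₁ (repOfChar χ) ↔ ∀ g h, f (g * h) = (χ g : ℂ) * f h + f g :=
  mem_cocycles₁_iff (A := repOfChar χ) f

theorem coc_zero (χ : G222 →* ℂˣ) (f : G222 → ℂ)
    (hf : ∀ g h, f (g * h) = (χ g : ℂ) * f h + f g) (h0 : ∀ i, f (gen222 i) = 0) (g : G222) :
    f g = 0 := by
  induction g using G222_ind with
  | h1 => simpa using hf 1 1
  | hg i => exact h0 i
  | hm g h hg hh => rw [hf, hg, hh]; simp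

def evalF (χ : G222 →* ℂˣ) : cocycles₁ (repOfChar χ) →ₗ[ℂ] (Fin 2 → ℂ) where
  toFun f := fun j => (show ℂ from f.1 (gen222 j.succ)) - (show ℂ from f.1 (gen222 0))
  map_add' f g := by
    funext j
    exact add_sub_add_comm (α := ℂ) _ _ _ _
  map_smul' c f := by
    funext j
    exact (mul_sub (α := ℂ) c _ _).symm

theorem evalF_surj (χ : G222 →* ℂˣ) (hχ : ∀ i : Fin 3, χ (gen222 i) = -1) :
    Function.Surjective (evalF χ) := by
  intro b
  let a : Fin 3 → ℂ := Fin.cons 0 b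
  refine ⟨⟨fun g => aff222 a g 0, (mem_coc χ _).2 fun g h => ?_⟩, ?_⟩
  · rw [map_mul, Equiv.Perm.mul_apply, aff222_apply χ hχ]
  · funext j
    change aff222 a (gen222 j.succ) 0 - aff222 a (gen222 0) 0 = b j
    rw [aff222_gen, aff222_gen]
    simp [a]

theorem evalF_ker (χ : G222 →* ℂˣ) (hχ : ∀ i : Fin 3, χ (gen222 i) = -1) :
    LinearMap.ker (evalF χ) = LinearMap.ker (H1π (repOfChar χ)).hom := by
  ext f
  rw [LinearMap.mem_ker, LinearMap.mem_ker]
  refine Iff.trans ?_ (H1π_eq_zero_iff f).symm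
  obtain ⟨f, hf⟩ := f
  change G222 → ℂ at f
  have hf' := (mem_coc χ f).1 hf
  constructor
  · intro h
    have h1 : ∀ j : Fin 2, f (gen222 j.succ) - f (gen222 0) = 0 := fun j => congrFun h j
    have h2 : ∀ i : Fin 3, f (gen222 i) = f (gen222 0) := by
      intro i
      refine Fin.cases rfl (fun j => sub_eq_zero.1 (h1 j)) i
    let x : ℂ := - f (gen222 0) / 2
    refine ⟨x, ?_⟩
    funext g
    change (χ g : ℂ) * x - x = f g
    have := coc_zero χ (fun g => f g - ((χ g : ℂ) * x - x)) (fun g h => by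
      simp only [hf' g h, map_mul, Units.val_mul]; ring) (fun i => by
      simp only [h2 i, hχ, x]; push_cast; ring) g
    exact (sub_eq_zero.1 this).symm
  · rintro ⟨x, hx⟩
    change ℂ at x
    have h1 : ∀ i, f (gen222 i) = -x - x := by
      intro i
      have : (χ (gen222 i) : ℂ) * x - x = f (gen222 i) := congrFun hx (gen222 i)
      rw [← this, hχ]; simp
    funext j
    change f (gen222 j.succ) - f (gen222 0) = 0
    rw [h1, h1, sub_self]

/-- For the character `χ : G → ℂˣ` of `G = C₂ * C₂ * C₂` with `χ(s₀) = χ(s₁) = χ(s₂) = −1`,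
the cohomology group `H¹(G, ℂ_χ)` is a complex vector space of dimension `2`. -/
theorem h1_dimension_eta4_character (χ : G222 →* ℂˣ)
    (hχ : ∀ i : Fin 3, χ (gen222 i) = -1) :
    Module.rank ℂ (groupCohomology.H1 (repOfChar χ)) = 2 := by
  have hs : Function.Surjective (H1π (repOfChar χ)).hom :=
    (ModuleCat.epi_iff_surjective (H1π (repOfChar χ))).1 inferInstance
  have e1 := LinearMap.quotKerEquivOfSurjective _ hs
  have e2 := LinearMap.quotKerEquivOfSurjective _ (evalF_surj χ hχ)
  have e3 := Submodule.quotEquivOfEq _ _ (evalF_ker χ hχ)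
  have e := (e1.symm.trans e3.symm).trans e2
  rw [e.rank_eq]
  simp
end
end

section
/- Let R₀ and R₁ denote the images in PSL₂(ℤ) of the matrices ST and T(ST)T⁻¹ respectively. Then the group homomorphism from the free product C₃ * C₃ of two cyclic groups of order 3 to PSL₂(ℤ) sending the generator of the first factor to R₀ and the generator of the second factor to R₁ is injective, and its image is a subgroup of PSL₂(ℤ) of index 2. -/
noncomputable section

/-- `SL₂(ℤ)`. -/
abbrev SL2Z : Type := Matrix.SpecialLinearGroup (Fin 2) ℤ

/-- `PSL₂(ℤ) = SL₂(ℤ)/{±I}`, the quotient of `SL₂(ℤ)` by its center. -/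
abbrev PSL2Z : Type := SL2Z ⧸ Subgroup.center SL2Z

/-- The projection `SL₂(ℤ) → PSL₂(ℤ)`. -/
def pmk : SL2Z →* PSL2Z := QuotientGroup.mk' (Subgroup.center SL2Z)

/-- `R₀`, the image in `PSL₂(ℤ)` of `ST`. -/
def R₀ : PSL2Z := pmk (ModularGroup.S * ModularGroup.T)

/-- `R₁`, the image in `PSL₂(ℤ)` of `T(ST)T⁻¹`. -/
def R₁ : PSL2Z := pmk (ModularGroup.T * (ModularGroup.S * ModularGroup.T) * ModularGroup.T⁻¹)

/-- `C₃ * C₃`, the free product of two cyclic groups of order 3. -/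
abbrev C3C3 : Type := Monoid.CoprodI (fun _ : Fin 2 => Multiplicative (ZMod 3))

/-- The two generators of `C₃ * C₃`, one for each free factor. -/
def genC3C3 (i : Fin 2) : C3C3 :=
  Monoid.CoprodI.of (i := i) (Multiplicative.ofAdd (1 : ZMod 3))

open Matrix ModularGroup

lemma pmk_eq_one_iff (A : SL2Z) : pmk A = 1 ↔ A ∈ Subgroup.center SL2Z :=
  QuotientGroup.eq_one_iff A

lemma neg_one_mem_ctr : (-1 : SL2Z) ∈ Subgroup.center SL2Z := by
  rw [Subgroup.mem_center_iff]; intro g; simp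

lemma mem_ctr {A : SL2Z} (h : A ∈ Subgroup.center SL2Z) : A = 1 ∨ A = -1 := by
  obtain ⟨r, hr, hA⟩ := Matrix.SpecialLinearGroup.mem_center_iff.mp h
  have : r = 1 ∨ r = -1 := by simpa using hr
  rcases this with rfl | rfl
  · left; ext i j; rw [← hA]; fin_cases i <;> fin_cases j <;> simp
  · right; ext i j; rw [← hA]; fin_cases i <;> fin_cases j <;> simp

lemma pmk_neg_one : pmk (-1) = 1 := (pmk_eq_one_iff _).2 neg_one_mem_ctr

lemma pmk_eq {A B : SL2Z} (h : pmk A = pmk B) : B = A ∨ B = -A := by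
  have : pmk (A⁻¹ * B) = 1 := by rw [map_mul, map_inv, h]; simp
  rcases mem_ctr ((pmk_eq_one_iff _).1 this) with h | h
  · left; exact (inv_mul_eq_one.1 h).symm
  · right; rw [inv_mul_eq_iff_eq_mul] at h; simpa using h

lemma R₀_cube : R₀ ^ 3 = 1 := by
  rw [R₀, ← map_pow, show (S * T) ^ 3 = (-1 : SL2Z) by decide, pmk_neg_one]

lemma R₁_eq : R₁ = pmk (T * S) := by
  rw [R₁]; congr 1; group

lemma R₁_cube : R₁ ^ 3 = 1 := by
  rw [R₁_eq, ← map_pow, show (T * S) ^ 3 = (-1 : SL2Z) by decide, pmk_neg_one]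

lemma S_sq : pmk S * pmk S = 1 := by
  rw [← map_mul, show S * S = (-1 : SL2Z) by decide, pmk_neg_one]

lemma S_R₀ : pmk S * R₀ = pmk T := by
  rw [R₀, map_mul, ← mul_assoc, S_sq, one_mul]

lemma T_S : pmk T * pmk S = R₁ := by
  rw [R₁_eq, map_mul]

/-- The image of the generator of the `i`-th factor. -/
def RR (i : Fin 2) : PSL2Z := if i = 0 then R₀ else R₁

lemma RR_cube (i : Fin 2) : RR i ^ 3 = 1 := by
  unfold RR; split_ifs
  exacts [R₀_cube, R₁_cube]

/-- The homomorphism on one factor. -/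
def facHom (i : Fin 2) : Multiplicative (ZMod 3) →* PSL2Z where
  toFun x := RR i ^ (x.toAdd.val)
  map_one' := by simp
  map_mul' x y := by
    rw [toAdd_mul, ZMod.val_add, ← pow_add]
    exact (pow_eq_pow_mod _ (RR_cube i)).symm

lemma f_of (f : C3C3 →* PSL2Z) (h0 : f (genC3C3 0) = R₀) (h1 : f (genC3C3 1) = R₁)
    (i : Fin 2) (m : Multiplicative (ZMod 3)) :
    f (Monoid.CoprodI.of (i := i) m) = RR i ^ m.toAdd.val := by
  have hm : m = (Multiplicative.ofAdd (1 : ZMod 3)) ^ m.toAdd.val := by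
    rw [← ofAdd_nsmul]; simp
  conv_lhs => rw [hm]
  rw [map_pow, map_pow]
  congr 1
  fin_cases i
  · exact h0
  · exact h1

lemma range_le (f : C3C3 →* PSL2Z) (h0 : f (genC3C3 0) = R₀) (h1 : f (genC3C3 1) = R₁)
    (H : Subgroup PSL2Z) (H0 : R₀ ∈ H) (H1 : R₁ ∈ H) : f.range ≤ H := by
  rintro _ ⟨x, rfl⟩
  induction x using Monoid.CoprodI.induction_on with
  | one => simp
  | of i m =>
    rw [f_of f h0 h1]
    apply H.pow_mem
    unfold RR; split_ifs <;> assumption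
  | mul x y hx hy => rw [map_mul]; exact H.mul_mem hx hy

/-- The alternating subgroup of `SL₂(𝔽₂)`. -/
def A3 : Subgroup (Matrix.SpecialLinearGroup (Fin 2) (ZMod 2)) where
  carrier := {g | g ^ 3 = 1}
  one_mem' := by simp
  mul_mem' := by
    intro a b; revert a b
    simp only [Set.mem_ofPred_eq]
    decide
  inv_mem' := by
    intro a h
    simp only [Set.mem_ofPred_eq] at *
    rw [inv_pow, h, inv_one]

/-- Its preimage in `SL₂(ℤ)`. -/
def K3 : Subgroup SL2Z := A3.comap (Matrix.SpecialLinearGroup.map (Int.castRingHom (ZMod 2)))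

lemma mem_K3 (g : SL2Z) :
    g ∈ K3 ↔ (Matrix.SpecialLinearGroup.map (Int.castRingHom (ZMod 2)) g) ^ 3 = 1 := Iff.rfl

lemma S_not_mem : pmk S ∉ K3.map pmk := by
  rintro ⟨M, hM, h⟩
  have h2 : S ∉ K3 := by rw [mem_K3]; decide
  have h3 : (-1 : SL2Z) ∈ K3 := by rw [mem_K3]; decide
  rcases pmk_eq h with h | h
  · exact h2 (h ▸ hM)
  · apply h2; rw [h, ← neg_one_mul]; exact K3.mul_mem h3 hM

lemma R₀_mem : R₀ ∈ K3.map pmk := ⟨S * T, by show _ ∈ K3; rw [mem_K3]; decide, rfl⟩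
lemma R₁_mem : R₁ ∈ K3.map pmk := ⟨T * S, by show _ ∈ K3; rw [mem_K3]; decide, R₁_eq.symm⟩

lemma cover (H : Subgroup PSL2Z) (H0 : R₀ ∈ H) (H1 : R₁ ∈ H) (g : SL2Z) :
    pmk g ∈ H ∨ pmk g * pmk S ∈ H := by
  have hg : g ∈ Subgroup.closure {S, T} := by simp [SpecialLinearGroup.SL2Z_generators]
  have hSi : (pmk S)⁻¹ = pmk S := inv_eq_of_mul_eq_one_left S_sq
  have stepS : ∀ b : PSL2Z, (b ∈ H ∨ b * pmk S ∈ H) → (b * pmk S ∈ H ∨ b * pmk S * pmk S ∈ H) := by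
    intro b hb
    rw [mul_assoc, S_sq, mul_one]; exact hb.symm
  induction hg using Subgroup.closure_induction_right with
  | one => left; simp
  | mul_right x hx y hy ih =>
    rcases hy with rfl | rfl
    · rw [map_mul]; exact stepS _ ih
    · rw [map_mul]
      rcases ih with ih | ih
      · right; rw [mul_assoc, T_S]; exact H.mul_mem ih H1
      · left; rw [← S_R₀, ← mul_assoc]; exact H.mul_mem ih H0
  | mul_inv_cancel x hx y hy ih =>
    rcases hy with rfl | rfl
    · rw [map_mul, map_inv, hSi]; exact stepS _ ih
    · rw [map_mul, map_inv]
      rcases ih with ih | ih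
      · right; rw [← S_R₀, _root_.mul_inv_rev, hSi, mul_assoc, mul_assoc, S_sq, mul_one]
        exact H.mul_mem ih (H.inv_mem H0)
      · left
        have : pmk x * (pmk T)⁻¹ = pmk x * pmk S * R₁⁻¹ := by
          rw [← T_S, _root_.mul_inv_rev]; group
        rw [this]; exact H.mul_mem ih (H.inv_mem H1)

/-- The ping-pong sets. -/
def XX (i : Fin 2) : Set PSL2Z :=
  if i = 0 then {q | ∃ M : SL2Z, pmk M = q ∧ M 0 0 * M 1 0 < 0}
  else {q | ∃ M : SL2Z, pmk M = q ∧ 0 < M 0 0 * M 1 0}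

lemma XX0 : XX 0 = {q | ∃ M : SL2Z, pmk M = q ∧ M 0 0 * M 1 0 < 0} := rfl
lemma XX1 : XX 1 = {q | ∃ M : SL2Z, pmk M = q ∧ 0 < M 0 0 * M 1 0} := rfl

lemma XX_disj : Disjoint (XX 0) (XX 1) := by
  rw [Set.disjoint_left, XX0, XX1]
  rintro _ ⟨M, rfl, h⟩ ⟨M', h', h2⟩
  rcases pmk_eq h' with rfl | rfl
  · linarith
  · simp at h; linarith

lemma ST00 (M : SL2Z) : (S * T * M) 0 0 = - M 1 0 := by
  simp [coe_S, coe_T, Matrix.mul_apply, Fin.sum_univ_two]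
lemma ST10 (M : SL2Z) : (S * T * M) 1 0 = M 0 0 + M 1 0 := by
  simp [coe_S, coe_T, Matrix.mul_apply, Fin.sum_univ_two]
lemma TS00 (M : SL2Z) : (T * S * M) 0 0 = M 0 0 - M 1 0 := by
  simp [coe_S, coe_T, Matrix.mul_apply, Fin.sum_univ_two]; ring
lemma TS10 (M : SL2Z) : (T * S * M) 1 0 = M 0 0 := by
  simp [coe_S, coe_T, Matrix.mul_apply, Fin.sum_univ_two]

lemma pp0 (q : PSL2Z) (hq : q ∈ XX 1) : R₀ * q ∈ XX 0 ∧ R₀ ^ 2 * q ∈ XX 0 := by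
  rw [XX1] at hq; rw [XX0]
  obtain ⟨M, rfl, h⟩ := hq
  refine ⟨⟨S * T * M, by rw [map_mul]; rfl, ?_⟩,
    ⟨S * T * (S * T * M), by rw [map_mul, map_mul _ _ M, pow_two, mul_assoc]; rfl, ?_⟩⟩
  · rw [ST00, ST10]; nlinarith [sq_nonneg (M 1 0)]
  · rw [ST00, ST10 (S * T * M), ST00, ST10]; nlinarith [sq_nonneg (M 0 0)]

lemma pp1 (q : PSL2Z) (hq : q ∈ XX 0) : R₁ * q ∈ XX 1 ∧ R₁ ^ 2 * q ∈ XX 1 := by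
  rw [XX0] at hq; rw [XX1]
  obtain ⟨M, rfl, h⟩ := hq
  refine ⟨⟨T * S * M, by rw [map_mul, R₁_eq], ?_⟩,
    ⟨T * S * (T * S * M), by rw [map_mul, map_mul _ _ M, pow_two, mul_assoc, R₁_eq], ?_⟩⟩
  · rw [TS00, TS10]; nlinarith [sq_nonneg (M 0 0)]
  · rw [TS00 (T * S * M), TS10 (T * S * M), TS00, TS10]; nlinarith [sq_nonneg (M 1 0)]

lemma val_cases (h : Multiplicative (ZMod 3)) (hh : h ≠ 1) :
    h.toAdd.val = 1 ∨ h.toAdd.val = 2 := by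
  revert h; decide

lemma f_inj (f : C3C3 →* PSL2Z) (h0 : f (genC3C3 0) = R₀) (h1 : f (genC3C3 1) = R₁) :
    Function.Injective f := by
  have hf : Monoid.CoprodI.lift
      (fun i => f.comp (Monoid.CoprodI.of (M := fun _ : Fin 2 => Multiplicative (ZMod 3)) (i := i)))
      = f := by
    ext i x; simp
  rw [← hf]
  apply Monoid.CoprodI.lift_injective_of_ping_pong _ _ XX
  · intro i
    fin_cases i
    · exact ⟨pmk ⟨!![1, 0; -1, 1], by simp⟩, ⟨_, rfl, by simp⟩⟩
    · exact ⟨pmk ⟨!![1, 0; 1, 1], by simp⟩, ⟨_, rfl, by simp⟩⟩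
  · intro i j hij
    fin_cases i <;> fin_cases j
    · exact absurd rfl hij
    · exact XX_disj
    · exact XX_disj.symm
    · exact absurd rfl hij
  · intro i j hij h hh
    rintro _ ⟨q, hq, rfl⟩
    change f (Monoid.CoprodI.of (i := i) h) * q ∈ XX i
    rw [f_of f h0 h1]
    fin_cases i <;> fin_cases j
    · exact absurd rfl hij
    · rcases val_cases h hh with e | e <;> rw [e]
      · rw [pow_one]; exact (pp0 q hq).1
      · exact (pp0 q hq).2
    · rcases val_cases h hh with e | e <;> rw [e]
      · rw [pow_one]; exact (pp1 q hq).1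
      · exact (pp1 q hq).2
    · exact absurd rfl hij
  · right
    refine ⟨0, ?_⟩
    rw [Cardinal.mk_fintype, Fintype.card_multiplicative, ZMod.card]
    norm_num

/-- The homomorphism `C₃ * C₃ → PSL₂(ℤ)` sending the generator of the first factor to
`R₀ = [ST]` and the generator of the second factor to `R₁ = [T(ST)T⁻¹]` exists, is
injective, and its image is a subgroup of `PSL₂(ℤ)` of index 2. -/
theorem free_product_embeds_index_two :
    (∃ f : C3C3 →* PSL2Z, f (genC3C3 0) = R₀ ∧ f (genC3C3 1) = R₁) ∧
    ∀ f : C3C3 →* PSL2Z, f (genC3C3 0) = R₀ → f (genC3C3 1) = R₁ →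
      Function.Injective f ∧ (MonoidHom.range f).index = 2 := by
  refine ⟨⟨Monoid.CoprodI.lift facHom, ?_, ?_⟩, ?_⟩
  · rw [genC3C3, Monoid.CoprodI.lift_of]; exact pow_one _
  · rw [genC3C3, Monoid.CoprodI.lift_of]; exact pow_one _
  · intro f h0 h1
    refine ⟨f_inj f h0 h1, ?_⟩
    have hS : pmk S ∉ f.range := fun h => S_not_mem (range_le f h0 h1 _ R₀_mem R₁_mem h)
    rw [Subgroup.index_eq_two_iff]
    refine ⟨pmk S, fun b => ?_⟩
    obtain ⟨g, rfl⟩ : ∃ g, pmk g = b := QuotientGroup.mk'_surjective _ b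
    rcases cover f.range ⟨_, h0⟩ ⟨_, h1⟩ g with h | h
    · exact Or.inr ⟨h, fun h' => hS ((Subgroup.mul_mem_cancel_left _ h).1 h')⟩
    · exact Or.inl ⟨h, fun h' => hS ((Subgroup.mul_mem_cancel_left _ h').1 h)⟩
end
end

section
/- Let S₀, S₁ and S₂ denote the images in PSL₂(ℤ) of the matrices S, TST⁻¹ and T²ST⁻² respectively. Then the group homomorphism from the free product C₂ * C₂ * C₂ of three cyclic groups of order 2 to PSL₂(ℤ) sending the three generators to S₀, S₁ and S₂ respectively is injective, and its image is a subgroup of PSL₂(ℤ) of index 3. -/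
noncomputable section

/-- `S₀`, the image in `PSL₂(ℤ)` of `S`. -/
def S₀ : PSL2Z := pmk ModularGroup.S

/-- `S₁`, the image in `PSL₂(ℤ)` of `TST⁻¹`. -/
def S₁ : PSL2Z := pmk (ModularGroup.T * ModularGroup.S * ModularGroup.T⁻¹)

/-- `S₂`, the image in `PSL₂(ℤ)` of `T²ST⁻²`. -/
def S₂ : PSL2Z :=
  pmk (ModularGroup.T ^ 2 * ModularGroup.S * (ModularGroup.T ^ 2)⁻¹)

/-- `C₂ * C₂ * C₂`, the free product of three cyclic groups of order 2. -/
abbrev C2C2C2 : Type := Monoid.CoprodI (fun _ : Fin 3 => Multiplicative (ZMod 2))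

/-- The three generators of `C₂ * C₂ * C₂`, one for each free factor. -/
def genC2C2C2 (i : Fin 3) : C2C2C2 :=
  Monoid.CoprodI.of (i := i) (Multiplicative.ofAdd (1 : ZMod 2))

open Matrix ModularGroup

theorem sl_mul (m n : SL2Z) (i j : Fin 2) :
    (m * n) i j = m i 0 * n 0 j + m i 1 * n 1 j :=
  (Matrix.mul_apply).trans (Fin.sum_univ_two _)

theorem aux_center {m : SL2Z} (h : m ∈ Subgroup.center SL2Z) :
    ∃ r : ℤ, r * r = 1 ∧ m 0 0 = r ∧ m 1 1 = r ∧ m 0 1 = 0 ∧ m 1 0 = 0 := by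
  rw [Matrix.SpecialLinearGroup.mem_center_iff] at h
  obtain ⟨r, hr, h⟩ := h
  have h' : ∀ i j, m i j = Matrix.scalar (Fin 2) r i j := fun i j => by rw [h]
  refine ⟨r, by simpa [sq] using hr, ?_, ?_, ?_, ?_⟩ <;> rw [h', Matrix.scalar_apply] <;>
    simp [Matrix.diagonal_apply, -Matrix.diagonal_intCast]

theorem aux_pmk {m n : SL2Z} (h : pmk m = pmk n) :
    ∃ r : ℤ, r * r = 1 ∧ n 0 0 = r * m 0 0 ∧ n 1 0 = r * m 1 0 := by
  have h' : m⁻¹ * n ∈ Subgroup.center SL2Z := QuotientGroup.eq.mp h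
  obtain ⟨r, hr, h1, -, -, h4⟩ := aux_center h'
  have e : n = m * (m⁻¹ * n) := by group
  refine ⟨r, hr, ?_, ?_⟩
  · rw [e]; rw [sl_mul, h1, h4]; ring
  · rw [e]; rw [sl_mul, h1, h4]; ring

theorem aux_pmk_neg {m n : SL2Z} (h : n = -m) : pmk m = pmk n := by
  apply QuotientGroup.eq.mpr
  rw [h, Subgroup.mem_center_iff]
  intro g
  simp

def matChi (a b c d : ZMod 3) : ZMod 3 := (1 - c ^ 2) * (b * d) + c * (a + d)

theorem matChi_mul : ∀ a b c d : ZMod 3, a * d - b * c = 1 →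
    ∀ a' b' c' d' : ZMod 3, a' * d' - b' * c' = 1 →
    matChi (a * a' + b * c') (a * b' + b * d') (c * a' + d * c') (c * b' + d * d') =
    matChi a b c d + matChi a' b' c' d' := by
  set_option maxRecDepth 100000 in
  set_option maxHeartbeats 4000000 in
  decide

def slChi : SL2Z →* Multiplicative (ZMod 3) where
  toFun m := Multiplicative.ofAdd (matChi (m 0 0 : ℤ) (m 0 1 : ℤ) (m 1 0 : ℤ) (m 1 1 : ℤ))
  map_one' := by simp [matChi]
  map_mul' m n := by
    have hm := congrArg (Int.cast : ℤ → ZMod 3) (m.det_coe)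
    have hn := congrArg (Int.cast : ℤ → ZMod 3) (n.det_coe)
    rw [Matrix.det_fin_two] at hm hn
    push_cast at hm hn
    rw [← ofAdd_add, ← matChi_mul _ _ _ _ hm _ _ _ _ hn]
    simp [Matrix.mul_apply, Fin.sum_univ_two]

def pslChi : PSL2Z →* Multiplicative (ZMod 3) :=
  QuotientGroup.lift (Subgroup.center SL2Z) slChi (by
    intro m hm
    obtain ⟨r, hr, h1, h2, h3, h4⟩ := aux_center hm
    simp [slChi, matChi, h3, h4])

theorem pslChi_pmk (m : SL2Z) : pslChi (pmk m) = slChi m := rfl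

theorem slChi_S : slChi S = 1 := by
  simp [slChi, matChi, ModularGroup.S]

theorem slChi_T : slChi T = Multiplicative.ofAdd 1 := by
  simp [slChi, matChi, ModularGroup.T]

def genS : Fin 3 → PSL2Z := ![S₀, S₁, S₂]

def matS : Fin 3 → SL2Z := ![S, T * S * T⁻¹, T ^ 2 * S * (T ^ 2)⁻¹]

theorem genS_eq (i : Fin 3) : genS i = pmk (matS i) := by
  fin_cases i <;> rfl

theorem genS_sq (i : Fin 3) : genS i * genS i = 1 := by
  rw [genS_eq, ← map_mul, ← map_one pmk]
  symm
  apply aux_pmk_neg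
  have hS : S * S = (-1 : SL2Z) := by
    decide
  fin_cases i
  · exact hS
  · calc T * S * T⁻¹ * (T * S * T⁻¹) = T * (S * S) * T⁻¹ := by group
      _ = _ := by rw [hS]; simp
  · calc T ^ 2 * S * (T ^ 2)⁻¹ * (T ^ 2 * S * (T ^ 2)⁻¹) = T ^ 2 * (S * S) * (T ^ 2)⁻¹ := by group
      _ = _ := by rw [hS]; simp

def condX : Fin 3 → ℤ → ℤ → Prop :=
  ![fun a c => a * c < 0, fun a c => 0 < a * c ∧ (a - 2 * c) * c < 0,
    fun a c => 0 < (a - 2 * c) * c]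

def ppX (i : Fin 3) : Set PSL2Z := {g | ∃ m : SL2Z, pmk m = g ∧ condX i (m 0 0) (m 1 0)}

theorem condX_scale (i : Fin 3) (r a c : ℤ) (hr : r * r = 1) (h : condX i (r * a) (r * c)) :
    condX i a c := by
  have e1 : r * a * (r * c) = a * c := by linear_combination (a * c) * hr
  have e2 : (r * a - 2 * (r * c)) * (r * c) = (a - 2 * c) * c := by
    linear_combination ((a - 2 * c) * c) * hr
  fin_cases i <;> simp [condX, e1, e2] at h ⊢ <;> exact h

theorem condX_disj (i j : Fin 3) (a c : ℤ) (h : condX i a c) (h' : condX j a c) : i = j := by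
  fin_cases i <;> fin_cases j <;> simp [condX] at h h' ⊢ <;> nlinarith [mul_self_nonneg c]

theorem ppX_nonempty (i : Fin 3) : (ppX i).Nonempty := by
  have h : ∀ x : ℤ, ∃ m : SL2Z, m 0 0 = x ∧ m 1 0 = 1 := fun x =>
    ⟨⟨!![x, -1; 1, 0], by simp [Matrix.det_fin_two]⟩, by simp, by simp⟩
  obtain ⟨m, h1, h2⟩ := h (![-1, 1, 3] i)
  refine ⟨pmk m, m, rfl, ?_⟩
  rw [h1, h2]
  fin_cases i <;> simp [condX]

theorem ppX_disj : Pairwise (Function.onFun Disjoint ppX) := by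
  intro i j hij
  rw [Function.onFun, Set.disjoint_left]
  rintro g ⟨m, rfl, hm⟩ ⟨n, hn, hn'⟩
  obtain ⟨r, hr, h1, h2⟩ := aux_pmk hn.symm
  rw [h1, h2] at hn'
  exact hij (condX_disj i j _ _ hm (condX_scale j r _ _ hr hn'))

theorem matS_apply (m : SL2Z) (i : Fin 3) :
    (matS i * m) 0 0 = ((i : ℕ) : ℤ) * m 0 0 - (((i : ℕ) : ℤ) ^ 2 + 1) * m 1 0 ∧
    (matS i * m) 1 0 = m 0 0 - ((i : ℕ) : ℤ) * m 1 0 := by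
  have h : ∀ i : Fin 3, matS i 0 0 = ((i : ℕ) : ℤ) ∧
    matS i 0 1 = - (((i : ℕ) : ℤ) ^ 2 + 1) ∧ matS i 1 0 = 1 ∧
    matS i 1 1 = - ((i : ℕ) : ℤ) := by decide
  obtain ⟨h1, h2, h3, h4⟩ := h i
  rw [sl_mul, sl_mul, h1, h2, h3, h4]
  constructor <;> ring

theorem genS_ping (i j : Fin 3) (hij : i ≠ j) (g : PSL2Z) (hg : g ∈ ppX j) :
    genS i * g ∈ ppX i := by
  obtain ⟨m, rfl, hm⟩ := hg
  refine ⟨matS i * m, by rw [map_mul, genS_eq], ?_⟩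
  rw [(matS_apply m i).1, (matS_apply m i).2]
  generalize m 0 0 = a at *
  generalize m 1 0 = c at *
  fin_cases i <;> fin_cases j <;> simp [condX] at hij hm ⊢ <;>
    first | nlinarith [mul_self_nonneg c, mul_self_nonneg a, mul_self_nonneg (a - 2 * c), mul_self_nonneg (a -  c)] |
    (constructor <;> nlinarith [mul_self_nonneg c, mul_self_nonneg a, mul_self_nonneg (a - 2 * c), mul_self_nonneg (a -  c)])

theorem c2_ne_one (h : Multiplicative (ZMod 2)) (hh : h ≠ 1) :
    h = Multiplicative.ofAdd (1 : ZMod 2) := by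
  revert h; decide

theorem f_inj_s11 (f : C2C2C2 →* PSL2Z) (hf : ∀ i, f (genC2C2C2 i) = genS i) :
    Function.Injective f := by
  have e : f = Monoid.CoprodI.lift (fun i => f.comp (Monoid.CoprodI.of (i := i))) := by
    ext i x; simp
  rw [e]
  refine Monoid.CoprodI.lift_injective_of_ping_pong _ (Or.inl (by simp)) ppX ppX_nonempty
    ppX_disj ?_
  intro i j hij h hh
  rw [c2_ne_one h hh]
  rintro _ ⟨g, hg, rfl⟩
  have := genS_ping i j hij g hg
  rw [← hf i] at this
  exact this

theorem f_range (f : C2C2C2 →* PSL2Z) (hf : ∀ i, f (genC2C2C2 i) = genS i) :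
    f.range = pslChi.ker := by
  have hle : ∀ i, genS i ∈ f.range := fun i => ⟨_, hf i⟩
  have hker : f.range ≤ pslChi.ker := by
    rw [MonoidHom.range_le_ker_iff]
    refine Monoid.CoprodI.ext_hom _ _ fun i => MonoidHom.ext fun x => ?_
    by_cases hx : x = 1
    · simp [hx]
    · rw [c2_ne_one x hx]
      change pslChi (f (genC2C2C2 i)) = 1
      rw [hf, genS_eq, pslChi_pmk]
      fin_cases i <;> simp [matS, slChi_S]
  apply le_antisymm hker
  · have hST : pmk (T ^ 3) ∈ f.range := by
      have e : pmk (T ^ 3) = genS 2 * genS 1 * genS 0 := by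
        rw [genS_eq, genS_eq, genS_eq, ← map_mul, ← map_mul]
        exact congrArg pmk (by decide)
      rw [e]
      exact mul_mem (mul_mem (hle _) (hle _)) (hle _)
    have key : ∀ g : SL2Z, ∃ h ∈ f.range, ∃ k < 3, pmk g = h * pmk (T ^ k) := by
      intro g
      have hg : g ∈ Subgroup.closure {S, T} := by
        rw [SpecialLinearGroup.SL2Z_generators]; trivial
      have hS : ∀ h ∈ f.range, ∀ k < 3, ∃ h' ∈ f.range, ∃ k' < 3,
          h * pmk (T ^ k) * pmk S = h' * pmk (T ^ k') := by
        intro h hh k hk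
        refine ⟨h * genS ⟨k, hk⟩, mul_mem hh (hle _), k, hk, ?_⟩
        rw [genS_eq, mul_assoc, mul_assoc, ← map_mul, ← map_mul]
        congr 2
        interval_cases k <;> simp [matS]
      have hSi : pmk S⁻¹ = pmk S := by
        have := genS_sq 0
        rw [map_inv]
        exact inv_eq_of_mul_eq_one_left this
      induction hg using Subgroup.closure_induction_right with
      | one => exact ⟨1, one_mem _, 0, by simp, by simp⟩
      | mul_right x hx y hy ih =>
        obtain ⟨h, hh, k, hk, e⟩ := ih
        rw [map_mul, e]
        rcases hy with rfl | rfl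
        · exact hS h hh k hk
        · by_cases h3 : k = 2
          · subst h3
            refine ⟨h * pmk (T ^ 3), mul_mem hh hST, 0, by simp, ?_⟩
            rw [mul_assoc, mul_assoc, ← map_mul, ← map_mul]
            congr 2
            rw [pow_zero, mul_one, pow_succ T 2]
          · refine ⟨h, hh, k + 1, by omega, ?_⟩
            rw [mul_assoc, ← map_mul, pow_succ]
      | mul_inv_cancel x hx y hy ih =>
        obtain ⟨h, hh, k, hk, e⟩ := ih
        rw [map_mul, e]
        rcases hy with rfl | rfl
        · rw [hSi]; exact hS h hh k hk
        · by_cases h3 : k = 0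
          · subst h3
            refine ⟨h * (pmk (T ^ 3))⁻¹, mul_mem hh (inv_mem hST), 2, by simp, ?_⟩
            rw [mul_assoc, mul_assoc, ← map_inv, ← map_mul, ← map_mul]
            congr 2
            group
          · obtain ⟨k, rfl⟩ := Nat.exists_eq_succ_of_ne_zero h3
            refine ⟨h, hh, k, by omega, ?_⟩
            rw [mul_assoc, ← map_mul, pow_succ]
            simp
    intro g hg
    obtain ⟨m, rfl⟩ := QuotientGroup.mk'_surjective _ g
    change pmk m ∈ _ at hg
    change pmk m ∈ _
    obtain ⟨h, hh, k, hk, e⟩ := key m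
    rw [e] at hg ⊢
    have h1 : pslChi h = 1 := hker hh
    rw [MonoidHom.mem_ker, map_mul, h1, one_mul, pslChi_pmk, map_pow, slChi_T] at hg
    have hk0 : k = 0 := by
      interval_cases k
      · rfl
      · exact absurd hg (by decide)
      · exact absurd hg (by decide)
    subst hk0
    simpa using hh

/-- The homomorphism `C₂ * C₂ * C₂ → PSL₂(ℤ)` sending the three generators to
`S₀ = [S]`, `S₁ = [TST⁻¹]` and `S₂ = [T²ST⁻²]` exists, is injective, and its image is a
subgroup of `PSL₂(ℤ)` of index 3. -/
theorem free_product_embeds_index_three :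
    (∃ f : C2C2C2 →* PSL2Z,
      f (genC2C2C2 0) = S₀ ∧ f (genC2C2C2 1) = S₁ ∧ f (genC2C2C2 2) = S₂) ∧
    ∀ f : C2C2C2 →* PSL2Z,
      f (genC2C2C2 0) = S₀ → f (genC2C2C2 1) = S₁ → f (genC2C2C2 2) = S₂ →
        Function.Injective f ∧ (MonoidHom.range f).index = 3 := by
  constructor
  · have hex : ∀ i : Fin 3, ∃ φ : Multiplicative (ZMod 2) →* PSL2Z,
        φ (Multiplicative.ofAdd 1) = genS i := by
      intro i
      refine ⟨MonoidHom.mk' (fun x => if x = 1 then 1 else genS i) ?_, ?_⟩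
      · intro a b
        by_cases ha : a = 1
        · simp [ha]
        by_cases hb : b = 1
        · simp [hb]
        have hab : a * b = 1 := by
          rw [c2_ne_one a ha, c2_ne_one b hb]; decide
        simp [ha, hb, hab, genS_sq]
      · have : (Multiplicative.ofAdd (1 : ZMod 2)) ≠ 1 := by decide
        simp [this]
    choose φ hφ using hex
    refine ⟨Monoid.CoprodI.lift φ, ?_, ?_, ?_⟩ <;>
      rw [genC2C2C2, Monoid.CoprodI.lift_of, hφ] <;> rfl
  · intro f h0 h1 h2
    have hf : ∀ i, f (genC2C2C2 i) = genS i := by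
      intro i
      fin_cases i
      · exact h0
      · exact h1
      · exact h2
    refine ⟨f_inj_s11 f hf, ?_⟩
    rw [f_range f hf, Subgroup.index_ker]
    have : pslChi.range = ⊤ := by
      rw [eq_top_iff]
      intro x _
      refine ⟨pmk (T ^ (x.toAdd.val)), ?_⟩
      rw [pslChi_pmk, map_pow, slChi_T, ← ofAdd_nsmul]
      simp
    rw [this]
    simp
end
end
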